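/- arXiv:1901.00185 — 2 statements merged into one kernel-verified Lean document; each statement's English description precedes it below -/
import Mathlib

section
/- Let P be a two-color grid poset with the max property and let L := J_color(P). Suppose L is M-structured for M = [[2,−1],[−3,2]]. Write (a,b) := wt(max). Then a ≥ 0 and b ≥ 0, the polynomial RGF(L,q) is symmetric and unimodal, and RGF(L,q)·(1−q)·(1−q)·(1−q²)·(1−q³)·(1−q⁴)·(1−q⁵) = (1−q^{a+1})(1−q^{b+1})(1−q^{a+b+2})(1−q^{a+2b+3})(1−q^{a+3b+4})(1−q^{2a+3b+5}) in ℤ[q]. -/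
open scoped Classical

structure GridData (P : Type) [PartialOrder P] where
  m : ℕ
  chain : P → ℕ
  color : P → Fin 2

def IsIdeal {P : Type} [PartialOrder P] (t : Finset P) : Prop :=
  ∀ ⦃x⦄, x ∈ t → ∀ ⦃y⦄, y ≤ x → y ∈ t

namespace GridData

variable {P : Type} [PartialOrder P] [Fintype P]

/-- The defining properties of a grid poset. -/
def IsGridPoset (G : GridData P) : Prop :=
  1 ≤ G.m ∧
  (∀ u : P, G.chain u ∈ Finset.Icc 1 G.m) ∧
  (∀ i ∈ Finset.Icc 1 G.m, ∃ u : P, G.chain u = i) ∧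
  (∀ u v : P, G.chain u = G.chain v → u ≤ v ∨ v ≤ u) ∧
  (∀ u v : P, u ⋖ v → G.chain u = G.chain v ∨ G.chain u = G.chain v + 1)

/-- The defining properties of a two-color grid poset. -/
def IsTwoColorGridPoset (G : GridData P) : Prop :=
  G.IsGridPoset ∧
  (∀ u v : P, G.chain u = G.chain v → G.color u = G.color v) ∧
  (∀ u v : P, Relation.ReflTransGen (fun x y : P => x ⋖ y ∨ y ⋖ x) u v →
    G.chain u = G.chain v + 1 → G.color u ≠ G.color v)

/-- The max property. -/
def MaxProperty (G : GridData P) : Prop :=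
  (∀ u : P, IsMax u → G.chain u ≤ 2) ∧
  (∀ u v : P, IsMax u → IsMax v → u ≠ v → G.color u ≠ G.color v)

/-- The fiber `C i` of the chain function. -/
def fiber (G : GridData P) (i : ℕ) : Finset P :=
  Finset.univ.filter (fun u => G.chain u = i)

/-- One step in a `γ`-component of `J_color(P)`: add or remove a single vertex of
color `γ` while both sets are order ideals. -/
def GStep (G : GridData P) (γ : Fin 2) (s t : Finset P) : Prop :=
  IsIdeal s ∧ IsIdeal t ∧ ∃ u : P, G.color u = γ ∧
    ((u ∉ s ∧ t = insert u s) ∨ (u ∉ t ∧ s = insert u t))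

/-- The `γ`-component of `t` in `J_color(P)`. -/
def comp (G : GridData P) (γ : Fin 2) (t : Finset P) : Set (Finset P) :=
  {s | Relation.ReflTransGen (G.GStep γ) t s}

noncomputable def minCard (G : GridData P) (γ : Fin 2) (t : Finset P) : ℕ :=
  sInf (Finset.card '' G.comp γ t)

noncomputable def maxCard (G : GridData P) (γ : Fin 2) (t : Finset P) : ℕ :=
  sSup (Finset.card '' G.comp γ t)

/-- `m_γ(t) = 2 ρ_γ(t) - l_γ(t)`. -/
noncomputable def mcoord (G : GridData P) (γ : Fin 2) (t : Finset P) : ℤ :=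
  2 * ((t.card : ℤ) - (G.minCard γ t : ℤ)) - ((G.maxCard γ t : ℤ) - (G.minCard γ t : ℤ))

/-- The weight of an element of `J_color(P)` (color `0` is α, color `1` is β). -/
noncomputable def wt (G : GridData P) (t : Finset P) : Fin 2 → ℤ :=
  ![G.mcoord 0 t, G.mcoord 1 t]

/-- `J_color(P)` is `M`-structured. -/
def MStructured (G : GridData P) (M : Matrix (Fin 2) (Fin 2) ℤ) : Prop :=
  ∀ s t : Finset P, IsIdeal s → IsIdeal t → ∀ u : P, u ∉ s → t = insert u s →
    G.wt s + M (G.color u) = G.wt t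

end GridData

open Polynomial in
/-- The rank generating function of the lattice of order ideals of P. -/
noncomputable def RGF (P : Type) [PartialOrder P] [Fintype P] : Polynomial ℤ :=
  ∑ t ∈ Finset.univ.filter (fun t : Finset P => IsIdeal t), X ^ t.card

/-- A polynomial `a_0 + a_1 q + ⋯ + a_l q^l` is symmetric if `a_i = a_{l-i}`. -/
def PolySymmetric (p : Polynomial ℤ) : Prop :=
  ∀ i ≤ p.natDegree, p.coeff i = p.coeff (p.natDegree - i)

/-- A polynomial is unimodal if its coefficients increase up to some index `k` and
decrease thereafter. -/
def PolyUnimodal (p : Polynomial ℤ) : Prop :=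
  ∃ k, (∀ i j, i ≤ j → j ≤ k → p.coeff i ≤ p.coeff j) ∧
    (∀ i j, k ≤ i → i ≤ j → j ≤ p.natDegree → p.coeff j ≤ p.coeff i)

namespace G2Uni

/-- The operator `e f^m` on an `h`-weight vector. -/
lemma sl2_comm {T : Type*} [AddCommGroup T] [Module ℚ T] (e f h : Module.End ℚ T)
    (hef : e * f - f * e = h) (hf : h * f - f * h = (-2 : ℚ) • f)
    (x : T) (n : ℚ) (hx : h x = n • x) (m : ℕ) :
    h ((f ^ m) x) = (n - 2 * m) • (f ^ m) x ∧
    e ((f ^ (m+1)) x) = (f ^ (m+1)) (e x) + ((m + 1 : ℚ) * (n - m)) • (f ^ m) x := by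
  have hef' : ∀ y, e (f y) = f (e y) + h y := fun y => by
    have := congrArg (fun g => g y) hef
    simp at this
    rw [← this]; abel
  have hf' : ∀ y, h (f y) = f (h y) + (-2 : ℚ) • f y := fun y => by
    have := congrArg (fun g => g y) hf
    simp at this
    simp [← this]
  have key : ∀ m : ℕ, h ((f ^ m) x) = (n - 2 * m) • (f ^ m) x := by
    intro m
    induction m with
    | zero => simp [hx]
    | succ k ih =>
      rw [pow_succ']
      simp only [Module.End.mul_apply]
      rw [hf', ih, map_smul, ← add_smul]
      congr 1; push_cast; ring
  refine ⟨key m, ?_⟩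
  induction m with
  | zero => simp [hef', hx]
  | succ k ih =>
    rw [pow_succ' f (k+1)]
    simp only [Module.End.mul_apply]
    rw [hef', ih, key, map_add, map_smul, add_assoc]
    congr 1
    have : f ((f ^ k) x) = (f ^ (k+1)) x := by rw [pow_succ']; rfl
    rw [this, ← add_smul]
    congr 1; push_cast; ring

lemma sl2_inj {T : Type*} [AddCommGroup T] [Module ℚ T] (e f h : Module.End ℚ T)
    (hef : e * f - f * e = h) (hf : h * f - f * h = (-2 : ℚ) • f)
    (he : h * e - e * h = (2 : ℚ) • e) (k : ℕ) :
    ∀ (n : ℕ) (x : T), h x = (n : ℚ) • x → (e ^ k) x = 0 → (f ^ n) x = 0 → x = 0 := by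
  induction k with
  | zero => intro n x _ h2 _; simpa using h2
  | succ k ih =>
    intro n x hx hk hn
    have hn1 : (f ^ (n+1)) x = 0 := by rw [pow_succ']; simp [hn]
    have hn2 : (f ^ (n+2)) x = 0 := by rw [pow_succ']; simp [hn1]
    have hex : e x = 0 := by
      apply ih (n+2) (e x)
      · have := congrArg (fun g => g x) he
        simp [hx] at this
        rw [sub_eq_iff_eq_add] at this
        rw [this, ← add_smul]; congr 1; push_cast; ring
      · rw [pow_succ] at hk; exact hk
      · have := (sl2_comm e f h hef hf x n hx (n+1)).2
        rw [hn1, hn2] at this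
        simpa using this.symm
    have : ∀ j : ℕ, j ≤ n → (f ^ (n - j)) x = 0 := by
      intro j
      induction j with
      | zero => intro _; simpa using hn
      | succ j ihj =>
        intro hj
        have h1 := ihj (by omega)
        have h2 := (sl2_comm e f h hef hf x n hx (n - (j+1))).2
        have h3 : n - (j+1) + 1 = n - j := by omega
        rw [h3, h1, hex] at h2
        simp only [map_zero, zero_add] at h2
        have h4 := (smul_eq_zero.mp h2.symm).resolve_left ?_
        · exact h4
        · have : ((n - (j+1) : ℕ) : ℚ) < n := by exact_mod_cast (by omega : n - (j+1) < n)
          apply mul_ne_zero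
          · positivity
          · linarith
    simpa using this n le_rfl

/-- Trace of an operator on an invariant subspace (zero if it is not invariant). -/
noncomputable def trOn {T : Type*} [AddCommGroup T] [Module ℚ T] (A : Submodule ℚ T)
    (g : Module.End ℚ T) : ℚ :=
  if h : ∀ x ∈ A, g x ∈ A then LinearMap.trace ℚ A (g.restrict h) else 0

section
variable {T : Type*} [AddCommGroup T] [Module ℚ T]

lemma trOn_of (A : Submodule ℚ T) (g : Module.End ℚ T) (h : ∀ x ∈ A, g x ∈ A) :
    trOn A g = LinearMap.trace ℚ A (g.restrict h) := dif_pos h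

lemma trOn_comm (A B : Submodule ℚ T) [FiniteDimensional ℚ A] [FiniteDimensional ℚ B]
    (e f : Module.End ℚ T) (hf : ∀ x ∈ A, f x ∈ B) (he : ∀ x ∈ B, e x ∈ A) :
    trOn A (e * f) = trOn B (f * e) := by
  have h1 : ∀ x ∈ A, (e * f) x ∈ A := fun x hx => he _ (hf x hx)
  have h2 : ∀ x ∈ B, (f * e) x ∈ B := fun x hx => hf _ (he x hx)
  rw [trOn_of A _ h1, trOn_of B _ h2]
  have := LinearMap.trace_comp_comm' (R := ℚ) (f.restrict hf) (e.restrict he)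
  exact this

lemma trOn_add (A : Submodule ℚ T) [FiniteDimensional ℚ A] (g g' : Module.End ℚ T)
    (h : ∀ x ∈ A, g x ∈ A) (h' : ∀ x ∈ A, g' x ∈ A) :
    trOn A (g + g') = trOn A g + trOn A g' := by
  rw [trOn_of A _ h, trOn_of A _ h', trOn_of A _ (fun x hx => A.add_mem (h x hx) (h' x hx)),
    ← map_add]
  rfl

lemma trOn_smul (A : Submodule ℚ T) [FiniteDimensional ℚ A] (c : ℚ) (g : Module.End ℚ T)
    (h : ∀ x ∈ A, g x ∈ A) :
    trOn A (c • g) = c * trOn A g := by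
  rw [trOn_of A _ h, trOn_of A _ (fun x hx => A.smul_mem c (h x hx)), ← smul_eq_mul, ← map_smul]
  rfl

lemma trOn_scalar (A : Submodule ℚ T) [FiniteDimensional ℚ A] (g : Module.End ℚ T) (c : ℚ)
    (h : ∀ x ∈ A, g x = c • x) :
    trOn A g = c * Module.finrank ℚ A := by
  rw [trOn_of A _ (fun x hx => by rw [h x hx]; exact A.smul_mem c hx)]
  have : g.restrict (fun x hx => by rw [h x hx]; exact A.smul_mem c hx : ∀ x ∈ A, g x ∈ A)
      = c • (LinearMap.id : A →ₗ[ℚ] A) := by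
    ext x; simp [h x x.2]
  rw [this, map_smul, LinearMap.trace_id, smul_eq_mul]
end

end G2Uni

namespace G2Uni

/-- Coordinates of the six positive roots with respect to the simple roots. -/
def rn : Fin 6 → ℤ := ![1, 0, 1, 2, 3, 3]
def rm : Fin 6 → ℤ := ![0, 1, 1, 1, 1, 2]
/-- Coordinates of the coroots. -/
def cx : Fin 6 → ℚ := ![1, 0, 1, 2, 1, 1]
def cy : Fin 6 → ℚ := ![0, 1, 3, 3, 1, 2]
/-- Half squared lengths. -/
def cc : Fin 6 → ℚ := ![1, 3, 1, 1, 3, 3]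

/-- Operators satisfying the (needed) relations of the Lie algebra `G₂`. -/
structure G2Ops (T : Type*) [AddCommGroup T] [Module ℚ T] where
  e : Fin 6 → Module.End ℚ T
  f : Fin 6 → Module.End ℚ T
  h1 : Module.End ℚ T
  h2 : Module.End ℚ T
  hef : ∀ r, e r * f r - f r * e r = cx r • h1 + cy r • h2
  e0f1 : e 0 * f 1 - f 1 * e 0 = 0
  e1f0 : e 1 * f 0 - f 0 * e 1 = 0
  h1f0 : h1 * f 0 - f 0 * h1 = (-2 : ℚ) • f 0
  h1f1 : h1 * f 1 - f 1 * h1 = (3 : ℚ) • f 1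
  h2f0 : h2 * f 0 - f 0 * h2 = (1 : ℚ) • f 0
  h2f1 : h2 * f 1 - f 1 * h2 = (-2 : ℚ) • f 1
  h1e0 : h1 * e 0 - e 0 * h1 = (2 : ℚ) • e 0
  h1e1 : h1 * e 1 - e 1 * h1 = (-3 : ℚ) • e 1
  h2e0 : h2 * e 0 - e 0 * h2 = (-1 : ℚ) • e 0
  h2e1 : h2 * e 1 - e 1 * h2 = (2 : ℚ) • e 1
  e2 : e 1 * e 0 - e 0 * e 1 = e 2
  e3 : e 2 * e 0 - e 0 * e 2 = (2 : ℚ) • e 3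
  e4 : e 3 * e 0 - e 0 * e 3 = (3 : ℚ) • e 4
  e5 : e 4 * e 1 - e 1 * e 4 = e 5
  f2 : f 0 * f 1 - f 1 * f 0 = f 2
  f3 : f 0 * f 2 - f 2 * f 0 = (2 : ℚ) • f 3
  f4 : f 0 * f 3 - f 3 * f 0 = (3 : ℚ) • f 4
  f5 : f 1 * f 4 - f 4 * f 1 = f 5
  f0f4 : f 0 * f 4 - f 4 * f 0 = 0
  f0f5 : f 0 * f 5 - f 5 * f 0 = 0
  f1f2 : f 1 * f 2 - f 2 * f 1 = 0
  f1f3 : f 1 * f 3 - f 3 * f 1 = 0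
  f1f5 : f 1 * f 5 - f 5 * f 1 = 0
  f0e2 : f 0 * e 2 - e 2 * f 0 = (-3 : ℚ) • e 1
  f0e3 : f 0 * e 3 - e 3 * f 0 = (-2 : ℚ) • e 2
  f0e4 : f 0 * e 4 - e 4 * f 0 = (-1 : ℚ) • e 3
  f0e5 : f 0 * e 5 - e 5 * f 0 = 0
  f1e2 : f 1 * e 2 - e 2 * f 1 = (1 : ℚ) • e 0
  f1e3 : f 1 * e 3 - e 3 * f 1 = 0
  f1e4 : f 1 * e 4 - e 4 * f 1 = 0
  f1e5 : f 1 * e 5 - e 5 * f 1 = (-1 : ℚ) • e 4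

namespace G2Ops
variable {T : Type*} [AddCommGroup T] [Module ℚ T] (O : G2Ops T)

/-- The Casimir operator. -/
noncomputable def Om : Module.End ℚ T :=
  (∑ r, cc r • (O.e r * O.f r + O.f r * O.e r)) + (2 : ℚ) • (O.h1 * O.h1) + (6 : ℚ) • (O.h2 * O.h1)
    + (6 : ℚ) • (O.h2 * O.h2)

lemma comm_lem {A : Type*} [Ring A] {x y z : A} (h : x * y - y * x = z) : x * y = y * x + z := by
  rw [← h]; abel

/-- Commutator with a fixed element, as an additive map. -/
def ad {A : Type*} [Ring A] (f x : A) : A := f * x - x * f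

lemma ad_add {A : Type*} [Ring A] (f x y : A) : ad f (x + y) = ad f x + ad f y := by
  unfold ad; noncomm_ring
lemma ad_mul {A : Type*} [Ring A] (f x y : A) : ad f (x * y) = ad f x * y + x * ad f y := by
  unfold ad; noncomm_ring
lemma ad_smul {A : Type*} [Ring A] [Algebra ℚ A] (c : ℚ) (f x : A) :
    ad f (c • x) = c • ad f x := by
  unfold ad; simp [smul_sub]
lemma ad_neg {A : Type*} [Ring A] {x y z : A} (h : x * y - y * x = z) : ad y x = - z := by
  unfold ad; rw [← h]; abel

lemma Om_f0 : O.Om * O.f 0 = O.f 0 * O.Om := by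
  have a0 := ad_neg (O.hef 0)
  have a1 := ad_neg O.e1f0
  have a2 : ad _ _ = _ := O.f0e2
  have a3 : ad _ _ = _ := O.f0e3
  have a4 : ad _ _ = _ := O.f0e4
  have a5 : ad _ _ = _ := O.f0e5
  have b0 : ad (O.f 0) (O.f 0) = 0 := sub_self _
  have b1 : ad _ _ = _ := O.f2
  have b2 : ad _ _ = _ := O.f3
  have b3 : ad _ _ = _ := O.f4
  have b4 : ad _ _ = _ := O.f0f4
  have b5 : ad _ _ = _ := O.f0f5
  have c1 := ad_neg O.h1f0
  have c2 := ad_neg O.h2f0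
  have d1 := comm_lem O.h1f0
  have d2 := comm_lem O.h2f0
  have key : ad (O.f 0) O.Om = 0 := by
    unfold Om
    simp only [Fin.sum_univ_six, ad_add, ad_smul, ad_mul, a0, a1, a2, a3, a4, a5, b0, b1, b2, b3,
      b4, b5, c1, c2, cc, cx, cy]
    simp [mul_add, add_mul, d1, d2]
    module
  exact (sub_eq_zero.mp key).symm

lemma Om_f1 : O.Om * O.f 1 = O.f 1 * O.Om := by
  have a0 := ad_neg O.e0f1
  have a1 := ad_neg (O.hef 1)
  have a2 : ad _ _ = _ := O.f1e2
  have a3 : ad _ _ = _ := O.f1e3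
  have a4 : ad _ _ = _ := O.f1e4
  have a5 : ad _ _ = _ := O.f1e5
  have b1 : ad (O.f 1) (O.f 1) = 0 := sub_self _
  have b0 := ad_neg O.f2
  have b2 : ad _ _ = _ := O.f1f2
  have b3 : ad _ _ = _ := O.f1f3
  have b4 : ad _ _ = _ := O.f5
  have b5 : ad _ _ = _ := O.f1f5
  have c1 := ad_neg O.h1f1
  have c2 := ad_neg O.h2f1
  have d1 := comm_lem O.h1f1
  have d2 := comm_lem O.h2f1
  have key : ad (O.f 1) O.Om = 0 := by
    unfold Om
    simp only [Fin.sum_univ_six, ad_add, ad_smul, ad_mul, a0, a1, a2, a3, a4, a5, b0, b1, b2, b3,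
      b4, b5, c1, c2, cc, cx, cy]
    simp [mul_add, add_mul, d1, d2]
    module
  exact (sub_eq_zero.mp key).symm

end G2Ops
end G2Uni

namespace G2Uni

/-- A highest weight vector for a family of `G₂`-operators, inside a finite dimensional invariant
subspace. -/
structure HW (T : Type*) [AddCommGroup T] [Module ℚ T] where
  O : G2Ops T
  v : T
  a : ℕ
  b : ℕ
  hv : v ≠ 0
  e0v : O.e 0 v = 0
  e1v : O.e 1 v = 0
  h1v : O.h1 v = (a : ℚ) • v
  h2v : O.h2 v = (b : ℚ) • v
  D : Submodule ℚ T
  hD : FiniteDimensional ℚ D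
  vD : v ∈ D
  f0D : ∀ x ∈ D, O.f 0 x ∈ D
  f1D : ∀ x ∈ D, O.f 1 x ∈ D

namespace HW
variable {T : Type*} [AddCommGroup T] [Module ℚ T] (S : HW T)

/-- Apply a word in the lowering operators to the highest weight vector. -/
def act : List Bool → T
  | [] => S.v
  | false :: w => S.O.f 0 (act w)
  | true :: w => S.O.f 1 (act w)

/-- The weight space of weight `λ - iα - jβ`. -/
def K (i j : ℤ) : Submodule ℚ T :=
  Submodule.span ℚ {x | ∃ w : List Bool, (w.count false : ℤ) = i ∧ (w.count true : ℤ) = j ∧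
    x = S.act w}

lemma act_mem (w : List Bool) : S.act w ∈ S.K (w.count false) (w.count true) :=
  Submodule.subset_span ⟨w, rfl, rfl, rfl⟩

/-- An operator that shifts weights. -/
def Sh (g : Module.End ℚ T) (n m : ℤ) : Prop := ∀ i j, ∀ x ∈ S.K i j, g x ∈ S.K (i + n) (j + m)

lemma Sh_of (g : Module.End ℚ T) (n m : ℤ)
    (h : ∀ w, g (S.act w) ∈ S.K (w.count false + n) (w.count true + m)) : S.Sh g n m := by
  intro i j x hx
  have : S.K i j ≤ (S.K (i+n) (j+m)).comap g := by
    refine Submodule.span_le.mpr ?_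
    rintro y ⟨w, rfl, rfl, rfl⟩
    exact h w
  exact this hx

variable {S} in
lemma Sh.mul {g g' : Module.End ℚ T} {n m n' m' : ℤ} (h : S.Sh g n m) (h' : S.Sh g' n' m') :
    S.Sh (g * g') (n + n') (m + m') := by
  intro i j x hx
  have := h _ _ _ (h' _ _ _ hx)
  rw [show i + (n + n') = i + n' + n by ring, show j + (m + m') = j + m' + m by ring]
  exact this

variable {S} in
lemma Sh.sub {g g' : Module.End ℚ T} {n m : ℤ} (h : S.Sh g n m) (h' : S.Sh g' n m) :
    S.Sh (g - g') n m := fun i j x hx => Submodule.sub_mem _ (h i j x hx) (h' i j x hx)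

variable {S} in
lemma Sh.comm {g g' : Module.End ℚ T} {n m n' m' : ℤ} (h : S.Sh g n m) (h' : S.Sh g' n' m') :
    S.Sh (g * g' - g' * g) (n + n') (m + m') := by
  refine (h.mul h').sub ?_
  have := h'.mul h
  rwa [add_comm n', add_comm m'] at this

variable {S} in
lemma Sh.smul {g : Module.End ℚ T} {n m : ℤ} (c : ℚ) (h : S.Sh g n m) :
    S.Sh (c • g) n m := fun i j x hx => Submodule.smul_mem _ c (h i j x hx)

lemma f0_sh : S.Sh (S.O.f 0) 1 0 := by
  apply Sh_of
  intro w
  have := S.act_mem (false :: w)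
  simpa [act] using this

lemma f1_sh : S.Sh (S.O.f 1) 0 1 := by
  apply Sh_of
  intro w
  have := S.act_mem (true :: w)
  simpa [act] using this

lemma ap {x y z : Module.End ℚ T} (h : x * y - y * x = z) (t : T) : x (y t) = y (x t) + z t := by
  rw [← h]; simp

lemma wt_word (w : List Bool) :
    S.O.h1 (S.act w) = ((S.a : ℚ) - 2 * (w.count false) + 3 * (w.count true)) • S.act w ∧
    S.O.h2 (S.act w) = ((S.b : ℚ) + (w.count false) - 2 * (w.count true)) • S.act w := by
  induction w with
  | nil => simp [act, S.h1v, S.h2v]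
  | cons c w ih =>
    cases c
    · constructor
      · rw [act, ap S.O.h1f0, ih.1]
        simp
        module
      · rw [act, ap S.O.h2f0, ih.2]
        simp
        module
    · constructor
      · rw [act, ap S.O.h1f1, ih.1]
        simp
        module
      · rw [act, ap S.O.h2f1, ih.2]
        simp
        module

lemma wt1 {i j : ℤ} {x : T} (hx : x ∈ S.K i j) : S.O.h1 x = ((S.a : ℚ) - 2 * i + 3 * j) • x := by
  refine Submodule.span_induction ?_ (by simp) ?_ ?_ hx
  · rintro x ⟨w, rfl, rfl, rfl⟩
    simpa using (S.wt_word w).1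
  · intro x y _ _ hx hy; rw [map_add, hx, hy, smul_add]
  · intro c x _ hx; rw [map_smul, hx, smul_comm]

lemma wt2 {i j : ℤ} {x : T} (hx : x ∈ S.K i j) : S.O.h2 x = ((S.b : ℚ) + i - 2 * j) • x := by
  refine Submodule.span_induction ?_ (by simp) ?_ ?_ hx
  · rintro x ⟨w, rfl, rfl, rfl⟩
    simpa using (S.wt_word w).2
  · intro x y _ _ hx hy; rw [map_add, hx, hy, smul_add]
  · intro c x _ hx; rw [map_smul, hx, smul_comm]

lemma e0_sh : S.Sh (S.O.e 0) (-1) 0 := by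
  apply Sh_of
  intro w
  induction w with
  | nil => simp [act, S.e0v]
  | cons c w ih =>
    cases c
    · rw [act, ap (S.O.hef 0)]
      refine Submodule.add_mem _ ?_ ?_
      · have := S.f0_sh _ _ _ ih
        simpa using this
      · have := S.act_mem w
        simp [cx, cy, (S.wt_word w).1]
        exact Submodule.smul_mem _ _ this
    · rw [act, ap (S.O.e0f1)]
      have := S.f1_sh _ _ _ ih
      simpa using this

lemma e1_sh : S.Sh (S.O.e 1) 0 (-1) := by
  apply Sh_of
  intro w
  induction w with
  | nil => simp [act, S.e1v]
  | cons c w ih =>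
    cases c
    · rw [act, ap (S.O.e1f0)]
      have := S.f0_sh _ _ _ ih
      simpa using this
    · rw [act, ap (S.O.hef 1)]
      refine Submodule.add_mem _ ?_ ?_
      · have := S.f1_sh _ _ _ ih
        simpa using this
      · have := S.act_mem w
        simp [cx, cy, (S.wt_word w).2]
        exact Submodule.smul_mem _ _ this

lemma f_sh : ∀ r, S.Sh (S.O.f r) (rn r) (rm r) := by
  have h0 := S.f0_sh
  have h1 := S.f1_sh
  have h2 : S.Sh (S.O.f 2) 1 1 := by have := h0.comm h1; rwa [S.O.f2] at this
  have h3 : S.Sh (S.O.f 3) 2 1 := by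
    have := (h0.comm h2).smul (1/2); rw [S.O.f3, smul_smul] at this; simpa using this
  have h4 : S.Sh (S.O.f 4) 3 1 := by
    have := (h0.comm h3).smul (1/3); rw [S.O.f4, smul_smul] at this; simpa using this
  have h5 : S.Sh (S.O.f 5) 3 2 := by have := h1.comm h4; rwa [S.O.f5] at this
  intro r
  fin_cases r <;> assumption

lemma e_sh : ∀ r, S.Sh (S.O.e r) (-rn r) (-rm r) := by
  have h0 := S.e0_sh
  have h1 := S.e1_sh
  have h2 : S.Sh (S.O.e 2) (-1) (-1) := by have := h1.comm h0; rwa [S.O.e2] at this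
  have h3 : S.Sh (S.O.e 3) (-2) (-1) := by
    have := (h2.comm h0).smul (1/2); rw [S.O.e3, smul_smul] at this; simpa using this
  have h4 : S.Sh (S.O.e 4) (-3) (-1) := by
    have := (h3.comm h0).smul (1/3); rw [S.O.e4, smul_smul] at this; simpa using this
  have h5 : S.Sh (S.O.e 5) (-3) (-2) := by have := h4.comm h1; rwa [S.O.e5] at this
  intro r
  fin_cases r <;> assumption

lemma K_neg {i j : ℤ} (h : i < 0 ∨ j < 0) : S.K i j = ⊥ := by
  unfold K
  convert Submodule.span_empty
  ext x
  simp only [Set.mem_ofPred_eq, Set.mem_empty_iff_false, iff_false]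
  rintro ⟨w, rfl, rfl, _⟩
  omega

lemma K_zero : S.K 0 0 = Submodule.span ℚ {S.v} := by
  unfold K
  congr 1
  ext x
  simp only [Set.mem_ofPred_eq, Set.mem_singleton_iff]
  constructor
  · rintro ⟨w, h1, h2, rfl⟩
    cases w with
    | nil => rfl
    | cons c w => cases c <;> simp at h1 h2 <;> omega
  · rintro rfl; exact ⟨[], rfl, rfl, rfl⟩

lemma act_D (w : List Bool) : S.act w ∈ S.D := by
  induction w with
  | nil => exact S.vD
  | cons c w ih => cases c <;> simp [act] <;> [exact S.f0D _ ih; exact S.f1D _ ih]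

lemma K_D (i j : ℤ) : S.K i j ≤ S.D := by
  refine Submodule.span_le.mpr ?_
  rintro x ⟨w, _, _, rfl⟩
  exact S.act_D w

instance K_fin (i j : ℤ) : FiniteDimensional ℚ (S.K i j) := by
  have := S.hD
  exact Submodule.finiteDimensional_of_le (S.K_D i j)

/-- The scalar by which the Casimir operator acts. -/
def cas : ℚ := 2 * S.a * S.a + 6 * S.b * S.a + 6 * S.b * S.b + 10 * S.a + 18 * S.b

lemma e_v (r : Fin 6) : S.O.e r S.v = 0 := by
  have h : S.O.e r S.v ∈ S.K (0 + -rn r) (0 + -rm r) := S.e_sh r 0 0 S.v (by simpa [act] using S.act_mem [])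
  rw [K_neg] at h
  · simpa using h
  · fin_cases r <;> simp [rn, rm]

lemma Om_word (w : List Bool) : S.O.Om (S.act w) = S.cas • S.act w := by
  induction w with
  | nil =>
    have key : ∀ r, S.O.e r (S.O.f r S.v) = (cx r * S.a + cy r * S.b) • S.v := by
      intro r
      rw [ap (S.O.hef r), e_v]
      simp [S.h1v, S.h2v, add_smul, mul_smul]
    simp only [act, G2Ops.Om, LinearMap.add_apply, LinearMap.sum_apply, LinearMap.smul_apply,
      Module.End.mul_apply, key, e_v, S.h1v, S.h2v, map_smul, Fin.sum_univ_six, map_zero, cas]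
    simp [cc, cx, cy]
    module
  | cons c w ih =>
    cases c
    · have := congrArg (fun g => g (S.act w)) S.O.Om_f0
      simp only [Module.End.mul_apply] at this
      rw [act, this, ih, map_smul]
    · have := congrArg (fun g => g (S.act w)) S.O.Om_f1
      simp only [Module.End.mul_apply] at this
      rw [act, this, ih, map_smul]

lemma Om_K {i j : ℤ} {x : T} (hx : x ∈ S.K i j) : S.O.Om x = S.cas • x := by
  refine Submodule.span_induction ?_ (by simp) ?_ ?_ hx
  · rintro x ⟨w, rfl, rfl, rfl⟩
    exact S.Om_word w
  · intro x y _ _ hx hy; rw [map_add, hx, hy, smul_add]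
  · intro c x _ hx; rw [map_smul, hx, smul_comm]

/-- Weight multiplicities. -/
noncomputable def M (i j : ℤ) : ℕ := Module.finrank ℚ (S.K i j)

/-- Partial traces. -/
noncomputable def U (r : Fin 6) (i j : ℤ) : ℚ := trOn (S.K i j) (S.O.e r * S.O.f r)

lemma M_neg {i j : ℤ} (h : i < 0 ∨ j < 0) : S.M i j = 0 := by
  rw [M, S.K_neg h]; simp

lemma M_zero : S.M 0 0 = 1 := by
  rw [M, S.K_zero]; exact finrank_span_singleton S.hv

/-- First coordinate of the weight. -/
def m1 (i j : ℤ) : ℚ := S.a - 2 * i + 3 * j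
/-- Second coordinate of the weight. -/
def m2 (i j : ℤ) : ℚ := S.b + i - 2 * j

lemma ef_inv (r : Fin 6) (i j : ℤ) : ∀ x ∈ S.K i j, (S.O.e r * S.O.f r) x ∈ S.K i j := by
  have := (S.e_sh r).mul (S.f_sh r)
  intro x hx
  simpa using this i j x hx

lemma fe_inv (r : Fin 6) (i j : ℤ) : ∀ x ∈ S.K i j, (S.O.f r * S.O.e r) x ∈ S.K i j := by
  have := (S.f_sh r).mul (S.e_sh r)
  intro x hx
  simpa using this i j x hx

lemma tr_fe (r : Fin 6) (i j : ℤ) : trOn (S.K i j) (S.O.f r * S.O.e r) =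
    S.U r (i - rn r) (j - rm r) := by
  rw [U, trOn_comm (S.K (i - rn r) (j - rm r)) (S.K i j)]
  · intro x hx; simpa using S.f_sh r _ _ x hx
  · intro x hx; exact S.e_sh r _ _ x hx

lemma R1 (r : Fin 6) (i j : ℤ) : S.U r i j - S.U r (i - rn r) (j - rm r) =
    (cx r * S.m1 i j + cy r * S.m2 i j) * S.M i j := by
  rw [← S.tr_fe, sub_eq_iff_eq_add', M, ← trOn_scalar (S.K i j) (cx r • S.O.h1 + cy r • S.O.h2),
    ← trOn_add _ _ _ (S.fe_inv r i j), U, ← S.O.hef r]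
  · congr 1; abel
  · rw [← S.O.hef r]
    intro x hx
    exact Submodule.sub_mem _ (S.ef_inv r i j x hx) (S.fe_inv r i j x hx)
  · intro x hx
    simp [S.wt1 hx, S.wt2 hx, m1, m2]
    module

lemma R2 (i j : ℤ) : S.cas * S.M i j = (2 * S.m1 i j ^ 2 + 6 * S.m1 i j * S.m2 i j
    + 6 * S.m2 i j ^ 2) * S.M i j + ∑ r, cc r * (S.U r i j + S.U r (i - rn r) (j - rm r)) := by
  have hH : ∀ x ∈ S.K i j, ((2 : ℚ) • (S.O.h1 * S.O.h1) + (6 : ℚ) • (S.O.h2 * S.O.h1)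
    + (6 : ℚ) • (S.O.h2 * S.O.h2)) x = (2 * S.m1 i j ^ 2 + 6 * S.m1 i j * S.m2 i j
    + 6 * S.m2 i j ^ 2) • x := by
    intro x hx
    simp [S.wt1 hx, S.wt2 hx, m1, m2]
    module
  have hs : ∀ s : Finset (Fin 6), (∀ x ∈ S.K i j, (∑ r ∈ s, cc r • (S.O.e r * S.O.f r + S.O.f r * S.O.e r)) x ∈ S.K i j) ∧ trOn (S.K i j) (∑ r ∈ s, cc r • (S.O.e r * S.O.f r + S.O.f r * S.O.e r)) =
      ∑ r ∈ s, cc r * (S.U r i j + S.U r (i - rn r) (j - rm r)) := by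
    intro s
    induction s using Finset.induction_on with
    | empty =>
      refine ⟨by simp, ?_⟩
      rw [trOn_scalar _ _ 0] <;> simp
    | insert r s hr ih =>
      have h1 : ∀ x ∈ S.K i j, (S.O.e r * S.O.f r + S.O.f r * S.O.e r) x ∈ S.K i j :=
        fun x hx => Submodule.add_mem _ (S.ef_inv r i j x hx) (S.fe_inv r i j x hx)
      have h2 : ∀ x ∈ S.K i j, (cc r • (S.O.e r * S.O.f r + S.O.f r * S.O.e r)) x ∈ S.K i j :=
        fun x hx => Submodule.smul_mem _ _ (h1 x hx)
      rw [Finset.sum_insert hr, Finset.sum_insert hr]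
      refine ⟨fun x hx => Submodule.add_mem _ (h2 x hx) (ih.1 x hx), ?_⟩
      rw [trOn_add _ _ _ h2 ih.1, ih.2, trOn_smul _ _ _ h1,
        trOn_add _ _ _ (S.ef_inv r i j) (S.fe_inv r i j), tr_fe]
      rfl
  rw [M, ← trOn_scalar (S.K i j) _ _ hH, ← (hs Finset.univ).2, add_comm (trOn _ _),
    ← trOn_add _ _ _ (hs _).1, ← trOn_scalar (S.K i j) S.O.Om S.cas (fun x hx => S.Om_K hx)]
  · rw [G2Ops.Om]; congr 1; abel
  · intro x hx; rw [hH x hx]; exact Submodule.smul_mem _ _ hx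

end HW
end G2Uni

namespace G2Uni

lemma finrank_iSup_indep {T : Type*} [AddCommGroup T] [Module ℚ T] {ι : Type} [Fintype ι]
    (p : ι → Submodule ℚ T) [∀ i, FiniteDimensional ℚ (p i)] (h : iSupIndep p) :
    Module.finrank ℚ (⨆ i, p i : Submodule ℚ T) = ∑ i, Module.finrank ℚ (p i) := by
  have h1 := h.dfinsupp_lsum_injective
  have h2 := Submodule.iSup_eq_range_dfinsupp_lsum p
  rw [h2, ← (LinearEquiv.ofInjective _ h1).finrank_eq]
  exact Module.finrank_directSum (R := ℚ) (fun i => p i)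

namespace HW
variable {T : Type*} [AddCommGroup T] [Module ℚ T] (S : HW T)

/-- The principal semisimple element. -/
def PH : Module.End ℚ T := (6 : ℚ) • S.O.h1 + (10 : ℚ) • S.O.h2
/-- The principal lowering operator. -/
def PF : Module.End ℚ T := S.O.f 0 + S.O.f 1
/-- The principal raising operator. -/
def PE : Module.End ℚ T := (6 : ℚ) • S.O.e 0 + (10 : ℚ) • S.O.e 1

lemma PH_K {i j : ℤ} {x : T} (hx : x ∈ S.K i j) :
    S.PH x = ((6 : ℚ) * S.a + 10 * S.b - 2 * (i + j)) • x := by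
  simp [PH, S.wt1 hx, S.wt2 hx]
  module

lemma drop_ne (w : List Bool) (h : S.act w ≠ 0) (l : ℕ) : S.act (w.drop l) ≠ 0 := by
  induction l generalizing w with
  | zero => simpa
  | succ l ih =>
    cases w with
    | nil => simpa
    | cons c w =>
      apply ih
      rintro h0
      apply h
      cases c <;> simp [act, h0]

lemma count_len (w : List Bool) : w.count false + w.count true = w.length := by
  induction w with
  | nil => simp
  | cons c w ih => cases c <;> simp <;> omega

lemma len_bound (w : List Bool) (h : S.act w ≠ 0) : w.length < Module.finrank ℚ S.D := by
  have hh := S.hD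
  let u : Fin (w.length + 1) → S.D := fun l => ⟨S.act (w.drop l), S.act_D _⟩
  have hu : LinearIndependent ℚ u := by
    apply LinearIndependent.of_comp S.D.subtype
    apply Module.End.eigenvectors_linearIndependent' S.PH
      (fun l : Fin (w.length + 1) => (6 : ℚ) * S.a + 10 * S.b - 2 * (w.length - (l:ℕ)))
    · intro l l' hl
      simp only at hl
      have : ((l : ℕ) : ℚ) = ((l' : ℕ) : ℚ) := by linarith
      exact Fin.ext (by exact_mod_cast this)
    · intro l
      refine ⟨?_, S.drop_ne w h l⟩
      rw [Module.End.mem_eigenspace_iff]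
      have h1 := S.PH_K (S.act_mem (w.drop l))
      have h2 := count_len (w.drop l)
      simp only [Function.comp, u, Submodule.subtype_apply]
      rw [h1]
      congr 1
      have h3 : ((w.drop l).count false : ℚ) + ((w.drop l).count true : ℚ) = w.length - (l : ℕ) := by
        rw [List.length_drop] at h2
        have := l.2
        have h4 : (w.drop l).count false + (w.drop l).count true + (l : ℕ) = w.length := by omega
        have h5 : ((w.drop l).count false : ℚ) + ((w.drop l).count true : ℚ) + (l : ℕ) = w.length := by
          exact_mod_cast h4
        linarith
      push_cast
      rw [h3]
  have := hu.fintype_card_le_finrank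
  simpa using this

lemma K_big {i j : ℤ} (h : (Module.finrank ℚ S.D : ℤ) ≤ i + j) : S.K i j = ⊥ := by
  unfold K
  rw [Submodule.span_eq_bot]
  rintro x ⟨w, h1, h2, rfl⟩
  by_contra h3
  have := S.len_bound w h3
  have := count_len w
  omega

lemma M_big {i j : ℤ} (h : (Module.finrank ℚ S.D : ℤ) ≤ i + j) : S.M i j = 0 := by
  rw [M, S.K_big h]; simp

lemma Sh_pow {g : Module.End ℚ T} {n m : ℤ} (h : S.Sh g n m) (k : ℕ) :
    S.Sh (g ^ k) (k * n) (k * m) := by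
  induction k with
  | zero => intro i j x hx; simpa using hx
  | succ k ih =>
    have := ih.mul h
    rw [pow_succ]
    convert this using 1 <;> push_cast <;> ring

lemma M_le (i j i' j' : ℤ) (g : Module.End ℚ T) (h : ∀ x ∈ S.K i j, g x ∈ S.K i' j')
    (hi : ∀ x ∈ S.K i j, g x = 0 → x = 0) : S.M i j ≤ S.M i' j' := by
  apply LinearMap.finrank_le_finrank_of_injective (f := g.restrict h)
  rw [← LinearMap.ker_eq_bot, LinearMap.ker_eq_bot']
  rintro ⟨x, hx⟩ h0
  have : g x = 0 := congrArg Subtype.val h0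
  exact Subtype.ext (hi x hx this)

/-- sl2 reflection of multiplicities in one direction. -/
lemma refl_le (e f h : Module.End ℚ T) (n m : ℤ) (he : S.Sh e (-n) (-m)) (hf : S.Sh f n m)
    (hef : e * f - f * e = h) (hhf : h * f - f * h = (-2 : ℚ) • f)
    (hhe : h * e - e * h = (2 : ℚ) • e) (k : ℕ) (i j : ℤ) (hk : ∀ x ∈ S.K i j, h x = (k : ℚ) • x)
    (hnil : ∃ l : ℕ, S.K (i - l * n) (j - l * m) = ⊥) :
    S.M i j ≤ S.M (i + k * n) (j + k * m) := by
  apply S.M_le _ _ _ _ (f ^ k) (S.Sh_pow hf k i j)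
  intro x hx h0
  obtain ⟨l, hl⟩ := hnil
  refine sl2_inj e f h hef hhf hhe l k x (hk x hx) ?_ h0
  have := S.Sh_pow he l i j x hx
  rw [show i + l * -n = i - l * n by ring, show j + l * -m = j - l * m by ring, hl] at this
  simpa using this

lemma hef0 : S.O.e 0 * S.O.f 0 - S.O.f 0 * S.O.e 0 = S.O.h1 := by
  rw [S.O.hef 0]; simp [cx, cy]
lemma hef1 : S.O.e 1 * S.O.f 1 - S.O.f 1 * S.O.e 1 = S.O.h2 := by
  rw [S.O.hef 1]; simp [cx, cy]

lemma M_s1 (i j : ℤ) : S.M i j = S.M (S.a - i + 3 * j) j := by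
  have key : ∀ i : ℤ, ∀ k : ℕ, (k : ℤ) = S.a - 2 * i + 3 * j → S.M i j = S.M (S.a - i + 3 * j) j := by
    intro i k hk
    have hk' : (k : ℚ) = S.a - 2 * i + 3 * j := by exact_mod_cast hk
    have h1 := S.refl_le _ _ _ 1 0 S.e0_sh S.f0_sh S.hef0 S.O.h1f0 S.O.h1e0 k i j
      (fun x hx => by rw [S.wt1 hx, hk']) ⟨(i+1).toNat, S.K_neg (by left; omega)⟩
    have h2 := S.refl_le (S.O.f 0) (S.O.e 0) (-S.O.h1) (-1) 0 (by simpa using S.f0_sh) S.e0_sh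
      (by rw [← S.hef0]; abel) (by
        have := S.O.h1e0
        rw [neg_smul, ← this]; noncomm_ring) (by
        have := S.O.h1f0
        rw [← neg_inj, ← neg_smul, ← this]; noncomm_ring) k (S.a - i + 3 * j) j
      (fun x hx => by
        rw [LinearMap.neg_apply, S.wt1 hx, hk', ← neg_smul]; congr 1; push_cast; ring)
      ⟨Module.finrank ℚ S.D + (i - S.a - 4 * j).toNat, S.K_big (by push_cast; omega)⟩
    apply le_antisymm
    · refine h1.trans_eq ?_; congr 1 <;> rw [hk] <;> ring
    · refine h2.trans_eq ?_; congr 1 <;> rw [hk] <;> ring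
  rcases le_total 0 (S.a - 2 * i + 3 * j) with h | h
  · exact key i (S.a - 2 * i + 3 * j).toNat (by omega)
  · have := key (S.a - i + 3 * j) (-(S.a - 2 * i + 3 * j)).toNat (by omega)
    rw [this]; congr 1; ring

lemma M_s2 (i j : ℤ) : S.M i j = S.M i (S.b + i - j) := by
  have key : ∀ j : ℤ, ∀ k : ℕ, (k : ℤ) = S.b + i - 2 * j → S.M i j = S.M i (S.b + i - j) := by
    intro j k hk
    have hk' : (k : ℚ) = S.b + i - 2 * j := by exact_mod_cast hk
    have h1 := S.refl_le _ _ _ 0 1 S.e1_sh S.f1_sh S.hef1 S.O.h2f1 S.O.h2e1 k i j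
      (fun x hx => by rw [S.wt2 hx, hk']) ⟨(j+1).toNat, S.K_neg (by right; omega)⟩
    have h2 := S.refl_le (S.O.f 1) (S.O.e 1) (-S.O.h2) 0 (-1) (by simpa using S.f1_sh) S.e1_sh
      (by rw [← S.hef1]; abel) (by
        have := S.O.h2e1
        rw [neg_smul, ← this]; noncomm_ring) (by
        have := S.O.h2f1
        rw [← neg_inj, ← neg_smul, ← this]; noncomm_ring) k i (S.b + i - j)
      (fun x hx => by
        rw [LinearMap.neg_apply, S.wt2 hx, hk', ← neg_smul]; congr 1; push_cast; ring)
      ⟨Module.finrank ℚ S.D + (j - S.b - 2 * i).toNat, S.K_big (by push_cast; omega)⟩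
    apply le_antisymm
    · refine h1.trans_eq ?_; congr 1 <;> rw [hk] <;> ring
    · refine h2.trans_eq ?_; congr 1 <;> rw [hk] <;> ring
  rcases le_total 0 (S.b + i - 2 * j) with h | h
  · exact key j (S.b + i - 2 * j).toNat (by omega)
  · have := key (S.b + i - j) (-(S.b + i - 2 * j)).toNat (by omega)
    rw [this]; congr 1; ring

/-- Graded pieces for the principal grading. -/
def Gr (k : ℕ) : Submodule ℚ T := ⨆ i : Fin (k + 1), S.K (i : ℕ) ((k : ℤ) - (i : ℕ))

lemma K_le_Gr (i j : ℤ) (k : ℕ) (h : i + j = k) : S.K i j ≤ S.Gr k := by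
  by_cases h0 : i < 0 ∨ j < 0
  · rw [S.K_neg h0]; exact bot_le
  · obtain ⟨i, rfl⟩ := Int.eq_ofNat_of_zero_le (by omega : 0 ≤ i)
    have := le_iSup (fun i : Fin (k + 1) => S.K (i : ℕ) ((k : ℤ) - (i : ℕ))) ⟨i, by omega⟩
    refine le_trans (le_of_eq ?_) this
    congr 1
    simp; omega

lemma Gr_finrank (k : ℕ) : Module.finrank ℚ (S.Gr k) = ∑ i ∈ Finset.range (k + 1), S.M i (k - i) := by
  rw [Gr, finrank_iSup_indep, Finset.sum_range]
  · rfl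
  · refine ((Module.End.eigenspaces_iSupIndep S.O.h1).comp
      (f := fun i : Fin (k + 1) => (S.a : ℚ) - 2 * (i : ℕ) + 3 * (k - (i : ℕ))) ?_).mono ?_
    · intro i i' h
      simp only at h
      have : ((i : ℕ) : ℚ) = ((i' : ℕ) : ℚ) := by linarith
      exact Fin.ext (by exact_mod_cast this)
    · intro i x hx
      simp only [Function.comp, Module.End.mem_eigenspace_iff]
      rw [S.wt1 hx]; push_cast; rfl

lemma Gr_PH {k : ℕ} {x : T} (hx : x ∈ S.Gr k) :
    S.PH x = ((6 : ℚ) * S.a + 10 * S.b - 2 * k) • x := by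
  refine Submodule.iSup_induction _ (motive := fun x => S.PH x = ((6 : ℚ) * S.a + 10 * S.b - 2 * k) • x)
    hx ?_ (by simp) ?_
  · intro i x hx
    rw [S.PH_K hx]; push_cast; congr 2; ring
  · intro x y hx hy; rw [map_add, hx, hy, smul_add]

lemma Gr_PF {k : ℕ} {x : T} (hx : x ∈ S.Gr k) : S.PF x ∈ S.Gr (k + 1) := by
  refine Submodule.iSup_induction _ (motive := fun x => S.PF x ∈ S.Gr (k + 1))
    hx ?_ (by simp) ?_
  · intro i x hx
    refine Submodule.add_mem _ ?_ ?_
    · exact S.K_le_Gr _ _ _ (by push_cast; ring) (S.f0_sh _ _ _ hx)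
    · exact S.K_le_Gr _ _ _ (by push_cast; ring) (S.f1_sh _ _ _ hx)
  · intro x y hx hy; rw [map_add]; exact Submodule.add_mem _ hx hy

lemma Gr_PE {k : ℕ} {x : T} (hx : x ∈ S.Gr (k + 1)) : S.PE x ∈ S.Gr k := by
  refine Submodule.iSup_induction _ (motive := fun x => S.PE x ∈ S.Gr k)
    hx ?_ (by simp) ?_
  · intro i x hx
    refine Submodule.add_mem _ (Submodule.smul_mem _ _ ?_) (Submodule.smul_mem _ _ ?_)
    · exact S.K_le_Gr _ _ _ (by push_cast; ring) (S.e0_sh _ _ _ hx)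
    · exact S.K_le_Gr _ _ _ (by push_cast; ring) (S.e1_sh _ _ _ hx)
  · intro x y hx hy; rw [map_add]; exact Submodule.add_mem _ hx hy

lemma Gr_zero {x : T} (hx : x ∈ S.Gr 0) : S.PE x = 0 := by
  refine Submodule.iSup_induction _ (motive := fun x => S.PE x = 0)
    hx ?_ (by simp) ?_
  · intro i x hx
    have h0 := (S.e0_sh _ _ _ hx)
    have h1 := (S.e1_sh _ _ _ hx)
    rw [S.K_neg (by left; omega), Submodule.mem_bot] at h0
    rw [S.K_neg (by right; simp), Submodule.mem_bot] at h1
    simp [PE, h0, h1]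
  · intro x y hx hy; rw [map_add, hx, hy, add_zero]

lemma Gr_nil (k : ℕ) {x : T} (hx : x ∈ S.Gr k) : (S.PE ^ (k + 1)) x = 0 := by
  induction k generalizing x with
  | zero => simpa using S.Gr_zero hx
  | succ k ih =>
    rw [pow_succ]
    exact ih (S.Gr_PE hx)

/-- Principal multiplicities. -/
noncomputable def kap (k : ℕ) : ℕ := ∑ i ∈ Finset.range (k + 1), S.M i (k - i)

instance Gr_fin (k : ℕ) : FiniteDimensional ℚ (S.Gr k) := by
  unfold Gr; infer_instance

lemma kap_mono (k : ℕ) (hk : k < 3 * S.a + 5 * S.b) : S.kap k ≤ S.kap (k + 1) := by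
  rw [kap, kap, ← Gr_finrank, ← Gr_finrank]
  have h : ∀ x ∈ S.Gr k, S.PF x ∈ S.Gr (k + 1) := fun x hx => S.Gr_PF hx
  apply LinearMap.finrank_le_finrank_of_injective (f := S.PF.restrict h)
  rw [← LinearMap.ker_eq_bot, LinearMap.ker_eq_bot']
  rintro ⟨x, hx⟩ h0
  have h0 : S.PF x = 0 := congrArg Subtype.val h0
  apply Subtype.ext
  obtain ⟨n, hn⟩ : ∃ n, n + 1 + 2 * k = 6 * S.a + 10 * S.b :=
    ⟨6 * S.a + 10 * S.b - 2 * k - 1, by omega⟩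
  refine sl2_inj S.PE S.PF S.PH ?_ ?_ ?_ (k + 1) (n + 1) x ?_ (S.Gr_nil k hx) ?_
  · have a1 := G2Ops.comm_lem S.hef0
    have a2 := G2Ops.comm_lem S.hef1
    have a3 := G2Ops.comm_lem S.O.e0f1
    have a4 := G2Ops.comm_lem S.O.e1f0
    simp [PE, PF, PH, mul_add, add_mul, a1, a2, a3, a4]
    module
  · have a1 := G2Ops.comm_lem S.O.h1f0
    have a2 := G2Ops.comm_lem S.O.h1f1
    have a3 := G2Ops.comm_lem S.O.h2f0
    have a4 := G2Ops.comm_lem S.O.h2f1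
    simp [PF, PH, mul_add, add_mul, a1, a2, a3, a4]
    module
  · have a1 := G2Ops.comm_lem S.O.h1e0
    have a2 := G2Ops.comm_lem S.O.h1e1
    have a3 := G2Ops.comm_lem S.O.h2e0
    have a4 := G2Ops.comm_lem S.O.h2e1
    simp [PE, PH, mul_add, add_mul, a1, a2, a3, a4]
    module
  · rw [S.Gr_PH hx]
    congr 1
    have : (n : ℚ) + 1 + 2 * k = 6 * S.a + 10 * S.b := by exact_mod_cast hn
    push_cast; linarith
  · rw [pow_succ]; simp [h0]

end HW
end G2Uni

namespace G2Uni

/-- Expansion of the Weyl denominator. -/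
def wd {A : Type*} [CommRing A] (p s : A) : A :=
  1 - p - s + p^4*s + p*s^2 - p^6*s^2 - p^4*s^4 + p^9*s^4 + p^6*s^5 - p^10*s^5 - p^9*s^6 + p^10*s^6

lemma wd_eq {A : Type*} [CommRing A] (p s : A) :
    wd p s = (1-p)*(1-s)*(1-p*s)*(1-p^2*s)*(1-p^3*s)*(1-p^3*s^2) := by
  unfold wd; ring

lemma pow_der {A : Type*} [CommRing A] [Algebra ℚ A] (d : Derivation ℚ A A) (x c : A)
    (h : d x = c * x) (i : ℕ) : d (x ^ i) = i * c * x ^ i := by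
  induction i with
  | zero => simp
  | succ i ih => rw [pow_succ, Derivation.leibniz, ih, h]; simp; ring

set_option maxHeartbeats 1600000 in
set_option maxRecDepth 10000 in
/-- The differential equation for the numerator of the character. -/
lemma cas_ring {A : Type*} [CommRing A] [Algebra ℚ A] (d1 d2 : Derivation ℚ A A) (p s : A)
    (h1 : d1 p = p) (h2 : d1 s = 0) (h3 : d2 p = 0) (h4 : d2 s = s)
    (a b : A) (da1 : d1 a = 0) (db1 : d1 b = 0) (m u0 u1 u2 u3 u4 u5 : A)
    (e0 : u0 - p * u0 = a * m - 2 * d1 m + 3 * d2 m)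
    (e1 : u1 - s * u1 = b * m + d1 m - 2 * d2 m)
    (e2 : u2 - p * s * u2 = (a * m - 2 * d1 m + 3 * d2 m) + 3 * (b * m + d1 m - 2 * d2 m))
    (e3 : u3 - p^2 * s * u3 = 2 * (a * m - 2 * d1 m + 3 * d2 m) + 3 * (b * m + d1 m - 2 * d2 m))
    (e4 : u4 - p^3 * s * u4 = (a * m - 2 * d1 m + 3 * d2 m) + (b * m + d1 m - 2 * d2 m))
    (e5 : u5 - p^3 * s^2 * u5 = (a * m - 2 * d1 m + 3 * d2 m) + 2 * (b * m + d1 m - 2 * d2 m))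
    (E : (10 * a + 18 * b) * m = - 2 * a * d1 m - 6 * b * d2 m + 2 * d1 (d1 m) - 6 * d1 (d2 m)
      + 6 * d2 (d2 m) + ((u0 + p * u0) + 3 * (u1 + s * u1) + (u2 + p * s * u2)
      + (u3 + p^2 * s * u3) + 3 * (u4 + p^3 * s * u4) + 3 * (u5 + p^3 * s^2 * u5))) :
    2 * d1 (d1 (wd p s * m)) - 6 * d1 (d2 (wd p s * m)) + 6 * d2 (d2 (wd p s * m))
      - 2 * (a + 1) * d1 (wd p s * m) - 6 * (b + 1) * d2 (wd p s * m) = 0 := by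
  have k1 : ∀ (i j : ℕ), d1 (p^i*s^j) = i * (p^i*s^j) := by
    intro i j
    rw [Derivation.leibniz, pow_der d1 p 1 (by simp [h1]), pow_der d1 s 0 (by simp [h2])]
    simp; ring
  have k2 : ∀ (i j : ℕ), d2 (p^i*s^j) = j * (p^i*s^j) := by
    intro i j
    rw [Derivation.leibniz, pow_der d2 p 0 (by simp [h3]), pow_der d2 s 1 (by simp [h4])]
    simp; ring
  have w : wd p s = p^0*s^0 - p^1*s^0 - p^0*s^1 + p^4*s^1 + p^1*s^2 - p^6*s^2 - p^4*s^4 + p^9*s^4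
    + p^6*s^5 - p^10*s^5 - p^9*s^6 + p^10*s^6 := by unfold wd; ring
  have l1 : ∀ (n i j : ℕ), d1 (n * (p^i*s^j)) = n * (i * (p^i*s^j)) := by
    intro n i j; rw [Derivation.leibniz, k1]; simp
  have l2 : ∀ (n i j : ℕ), d2 (n * (p^i*s^j)) = n * (j * (p^i*s^j)) := by
    intro n i j; rw [Derivation.leibniz, k2]; simp
  have D1 : ∃ x, x = d1 (wd p s) := ⟨_, rfl⟩
  have D2 : ∃ x, x = d2 (wd p s) := ⟨_, rfl⟩
  obtain ⟨x1, hx1⟩ := D1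
  obtain ⟨x2, hx2⟩ := D2
  simp only [Derivation.leibniz, map_add, smul_eq_mul]
  have v1 := hx1
  have v2 := hx2
  rw [w] at v1 v2
  simp only [map_add, map_sub, k1, k2] at v1 v2
  have v11 := congrArg d1 v1
  have v12 := congrArg d1 v2
  have v22 := congrArg d2 v2
  simp only [map_add, map_sub, l1, l2] at v11 v12 v22
  rw [← hx1, ← hx2, v11, v12, v22, v1, v2, w]
  simp only [Nat.cast_ofNat, Nat.cast_zero, Nat.cast_one]
  linear_combination (exp := 1) (-((1-p)*(1-s)*(1-p*s)*(1-p^2*s)*(1-p^3*s)*(1-p^3*s^2))) * E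
    - (1+p)*(1-s)*(1-p*s)*(1-p^2*s)*(1-p^3*s)*(1-p^3*s^2) * e0
    - 3*(1-p)*(1+s)*(1-p*s)*(1-p^2*s)*(1-p^3*s)*(1-p^3*s^2) * e1
    - (1-p)*(1-s)*(1+p*s)*(1-p^2*s)*(1-p^3*s)*(1-p^3*s^2) * e2
    - (1-p)*(1-s)*(1-p*s)*(1+p^2*s)*(1-p^3*s)*(1-p^3*s^2) * e3
    - 3*(1-p)*(1-s)*(1-p*s)*(1-p^2*s)*(1+p^3*s)*(1-p^3*s^2) * e4
    - 3*(1-p)*(1-s)*(1-p*s)*(1-p^2*s)*(1-p^3*s)*(1+p^3*s^2) * e5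
end G2Uni

namespace G2Uni

/-- Two-variable polynomials. -/
abbrev R2v := MvPolynomial (Fin 2) ℚ

/-- Exponent vector. -/
noncomputable def ex (i j : ℕ) : Fin 2 →₀ ℕ := Finsupp.single 0 i + Finsupp.single 1 j

lemma ex0 (i j : ℕ) : ex i j 0 = i := by simp [ex]
lemma ex1 (i j : ℕ) : ex i j 1 = j := by simp [ex]
lemma ex_eta (m : Fin 2 →₀ ℕ) : ex (m 0) (m 1) = m := by
  ext i; fin_cases i <;> simp [ex]
lemma ex_inj {i j i' j' : ℕ} : ex i j = ex i' j' ↔ i = i' ∧ j = j' := by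
  constructor
  · intro h; exact ⟨by rw [← ex0 i j, h, ex0], by rw [← ex1 i j, h, ex1]⟩
  · rintro ⟨rfl, rfl⟩; rfl

/-- Coefficient with integer indices. -/
noncomputable def cf (f : R2v) (i j : ℤ) : ℚ :=
  if 0 ≤ i ∧ 0 ≤ j then MvPolynomial.coeff (ex i.toNat j.toNat) f else 0

lemma cf_nat (f : R2v) (i j : ℕ) : cf f i j = MvPolynomial.coeff (ex i j) f := by
  simp [cf]

lemma cf_ext {f g : R2v} (h : ∀ i j, cf f i j = cf g i j) : f = g := by
  ext m
  rw [← ex_eta m, ← cf_nat, ← cf_nat, h]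

lemma cf_add (f g : R2v) (i j : ℤ) : cf (f + g) i j = cf f i j + cf g i j := by
  unfold cf; split_ifs <;> simp
lemma cf_sub (f g : R2v) (i j : ℤ) : cf (f - g) i j = cf f i j - cf g i j := by
  unfold cf; split_ifs <;> simp
lemma cf_C (c : ℚ) (f : R2v) (i j : ℤ) : cf (MvPolynomial.C c * f) i j = c * cf f i j := by
  unfold cf; split_ifs <;> simp

/-- The monomial with given exponents. -/
noncomputable def mon (i j : ℕ) : R2v := MvPolynomial.X 0 ^ i * MvPolynomial.X 1 ^ j

lemma mon_eq (i j : ℕ) : mon i j = MvPolynomial.monomial (ex i j) 1 := by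
  rw [mon, MvPolynomial.X_pow_eq_monomial, MvPolynomial.X_pow_eq_monomial,
    MvPolynomial.monomial_mul, ex, one_mul]

lemma cf_mon (n m : ℕ) (i j : ℤ) : cf (mon n m) i j = if i = n ∧ j = m then 1 else 0 := by
  unfold cf
  rw [mon_eq, MvPolynomial.coeff_monomial]
  simp only [ex_inj]
  split_ifs <;> first | rfl | (exfalso; omega)

lemma ex_le {n m i j : ℕ} : ex n m ≤ ex i j ↔ n ≤ i ∧ m ≤ j := by
  rw [Finsupp.le_def]
  constructor
  · intro h; have h0 := h 0; have h1 := h 1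
    simp only [ex0, ex1] at h0 h1; exact ⟨h0, h1⟩
  · rintro ⟨h0, h1⟩ k; fin_cases k <;> simp [ex] <;> assumption

lemma cf_mon_mul (n m : ℕ) (f : R2v) (i j : ℤ) : cf (mon n m * f) i j = cf f (i - n) (j - m) := by
  unfold cf
  rw [mon_eq, MvPolynomial.coeff_monomial_mul']
  simp only [ex_le]
  split_ifs with h1 h2 h3 h3 h3 <;> try (first | rfl | (exfalso; omega))
  rw [one_mul]
  congr 1
  ext k
  fin_cases k <;> simp [ex]

/-- Euler derivation. -/
noncomputable def eu (k : Fin 2) : Derivation ℚ R2v R2v :=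
  (MvPolynomial.X k : R2v) • MvPolynomial.pderiv k

lemma eu_mon (k : Fin 2) (m : Fin 2 →₀ ℕ) (c : ℚ) :
    eu k (MvPolynomial.monomial m c) = MvPolynomial.monomial m (m k * c) := by
  simp only [eu, Derivation.smul_apply, MvPolynomial.pderiv_monomial, smul_eq_mul]
  by_cases h : m k = 0
  · simp [h]
  · rw [MvPolynomial.X, MvPolynomial.monomial_mul, one_mul, mul_comm c]
    congr 2
    ext l
    simp only [Finsupp.add_apply, Finsupp.tsub_apply, Finsupp.single_apply]
    split_ifs with h'
    · subst h'; omega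
    · omega

lemma coeff_eu (k : Fin 2) (m : Fin 2 →₀ ℕ) (f : R2v) :
    MvPolynomial.coeff m (eu k f) = m k * MvPolynomial.coeff m f := by
  induction f using MvPolynomial.induction_on' with
  | monomial u a =>
    rw [eu_mon, MvPolynomial.coeff_monomial, MvPolynomial.coeff_monomial]
    split_ifs with h
    · rw [h]
    · simp
  | add p q hp hq => simp [hp, hq, mul_add]

lemma cf_eu0 (f : R2v) (i j : ℤ) : cf (eu 0 f) i j = i * cf f i j := by
  unfold cf
  split_ifs with h
  · rw [coeff_eu, ex0]
    congr 1
    have : ((i.toNat : ℤ) : ℚ) = i := by rw [Int.toNat_of_nonneg h.1]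
    exact_mod_cast this
  · simp

lemma cf_eu1 (f : R2v) (i j : ℤ) : cf (eu 1 f) i j = j * cf f i j := by
  unfold cf
  split_ifs with h
  · rw [coeff_eu, ex1]
    congr 1
    have : ((j.toNat : ℤ) : ℚ) = j := by rw [Int.toNat_of_nonneg h.2]
    exact_mod_cast this
  · simp

/-- The polynomial with prescribed coefficients. -/
noncomputable def gf (N : ℕ) (φ : ℤ → ℤ → ℚ) : R2v :=
  ∑ k ∈ Finset.range N, ∑ x ∈ Finset.HasAntidiagonal.antidiagonal k, MvPolynomial.C (φ x.1 x.2) * mon x.1 x.2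

lemma cf_sum {ι : Type*} (s : Finset ι) (g : ι → R2v) (i j : ℤ) :
    cf (∑ x ∈ s, g x) i j = ∑ x ∈ s, cf (g x) i j := by
  unfold cf; split_ifs
  · rw [MvPolynomial.coeff_sum]
  · simp

lemma cf_gf (N : ℕ) (φ : ℤ → ℤ → ℚ) (h1 : ∀ i j, i < 0 ∨ j < 0 → φ i j = 0)
    (h2 : ∀ i j, (N : ℤ) ≤ i + j → φ i j = 0) (i j : ℤ) : cf (gf N φ) i j = φ i j := by
  simp only [gf, cf_sum, cf_C, cf_mon]
  by_cases hn : i < 0 ∨ j < 0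
  · rw [h1 i j hn]
    apply Finset.sum_eq_zero; intro k _
    apply Finset.sum_eq_zero; intro x _
    rw [if_neg (by omega), mul_zero]
  obtain ⟨i, rfl⟩ := Int.eq_ofNat_of_zero_le (by omega : 0 ≤ i)
  obtain ⟨j, rfl⟩ := Int.eq_ofNat_of_zero_le (by omega : 0 ≤ j)
  by_cases hN : N ≤ i + j
  · rw [h2 i j (by omega)]
    apply Finset.sum_eq_zero; intro k hk
    apply Finset.sum_eq_zero; intro x hx
    simp only [Finset.mem_range, Finset.HasAntidiagonal.mem_antidiagonal] at hk hx
    rw [if_neg (by omega), mul_zero]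
  · rw [Finset.sum_eq_single (i + j), Finset.sum_eq_single (i, j)]
    · simp
    · rintro ⟨x, y⟩ _ hne
      rw [if_neg, mul_zero]
      rintro ⟨h, h'⟩
      exact hne (by simp at h h'; simp [h, h'])
    · intro h; exact absurd (by simp) h
    · intro k _ hk
      apply Finset.sum_eq_zero; intro x hx
      simp only [Finset.HasAntidiagonal.mem_antidiagonal] at hx
      rw [if_neg (by omega), mul_zero]
    · intro h; exact absurd (Finset.mem_range.mpr (by omega)) h

end G2Uni

namespace G2Uni
namespace HW
variable {T : Type*} [AddCommGroup T] [Module ℚ T] (S : HW T)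

/-- `(|λ+ρ|² - |λ+ρ-iα-jβ|²)/2`. -/
def qq (i j : ℤ) : ℤ := (S.a + 1) * i + 3 * (S.b + 1) * j - i ^ 2 + 3 * i * j - 3 * j ^ 2

lemma supp (n : ℕ) : ∀ i j : ℤ, i + j ≤ n → S.M i j ≠ 0 → (i = 0 ∧ j = 0) ∨ 0 < S.qq i j := by
  induction n with
  | zero =>
    intro i j h hM
    have : ¬ (i < 0 ∨ j < 0) := fun h => hM (S.M_neg h)
    left; omega
  | succ n ih =>
    intro i j h hM
    have hn : ¬ (i < 0 ∨ j < 0) := fun h => hM (S.M_neg h)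
    push Not at hn
    by_cases h1 : S.a - 2 * i + 3 * j < 0
    · right
      have h2 := ih (S.a - i + 3 * j) j (by push_cast at h; omega) (by rwa [← S.M_s1])
      have h3 : S.qq i j = S.qq (S.a - i + 3 * j) j - (S.a - 2 * i + 3 * j) := by
        unfold qq; ring
      have h4 : 0 ≤ S.qq (S.a - i + 3 * j) j := by
        rcases h2 with ⟨h, h'⟩ | h
        · rw [h, h']; simp [qq]
        · exact h.le
      omega
    by_cases h1' : S.b + i - 2 * j < 0
    · right
      have h2 := ih i (S.b + i - j) (by push_cast at h; omega) (by rwa [← S.M_s2])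
      have h3 : S.qq i j = S.qq i (S.b + i - j) - 3 * (S.b + i - 2 * j) := by
        unfold qq; ring
      have h4 : 0 ≤ S.qq i (S.b + i - j) := by
        rcases h2 with ⟨h, h'⟩ | h
        · rw [h', h]; simp [qq]
        · exact h.le
      omega
    by_cases h0 : i = 0 ∧ j = 0
    · left; exact h0
    right
    have h5 : 2 * S.qq i j = i * (S.a + (S.a - 2 * i + 3 * j) + 2)
      + 3 * (j * (S.b + (S.b + i - 2 * j) + 2)) := by unfold qq; ring
    have h6 : 2 * i ≤ i * (S.a + (S.a - 2 * i + 3 * j) + 2) := by nlinarith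
    have h7 : 2 * j ≤ j * (S.b + (S.b + i - 2 * j) + 2) := by nlinarith
    omega

lemma M_on (i j : ℤ) (h : S.qq i j = 0) : S.M i j = if i = 0 ∧ j = 0 then 1 else 0 := by
  split_ifs with h0
  · rw [h0.1, h0.2, S.M_zero]
  · by_contra h1
    have := S.supp (i + j).toNat i j (by omega) h1
    omega

/-- Number of boxes bound. -/
noncomputable def N : ℕ := Module.finrank ℚ S.D

/-- Generating function of the multiplicities. -/
noncomputable def mg : R2v := gf S.N (fun i j => S.M i j)
/-- Generating function of the traces. -/
noncomputable def ug (r : Fin 6) : R2v := gf S.N (fun i j => S.U r i j)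

lemma cf_mg (i j : ℤ) : cf S.mg i j = S.M i j := by
  refine cf_gf _ _ ?_ ?_ i j
  · intro i j h; simp [S.M_neg h]
  · intro i j h; simp [S.M_big h]

lemma U_bot (r : Fin 6) {i j : ℤ} (h : S.K i j = ⊥) : S.U r i j = 0 := by
  rw [U, trOn_scalar _ _ 0]
  · simp
  · intro x hx
    rw [h, Submodule.mem_bot] at hx
    simp [hx]

lemma cf_ug (r : Fin 6) (i j : ℤ) : cf (S.ug r) i j = S.U r i j := by
  refine cf_gf _ _ ?_ ?_ i j
  · intro i j h; exact S.U_bot r (S.K_neg h)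
  · intro i j h; exact S.U_bot r (S.K_big h)

lemma ug_eq (r : Fin 6) (n m : ℕ) (hn : rn r = n) (hm : rm r = m) :
    S.ug r - mon n m * S.ug r = MvPolynomial.C (cx r) * (MvPolynomial.C (S.a : ℚ) * S.mg
      - MvPolynomial.C 2 * eu 0 S.mg + MvPolynomial.C 3 * eu 1 S.mg)
      + MvPolynomial.C (cy r) * (MvPolynomial.C (S.b : ℚ) * S.mg
      + eu 0 S.mg - MvPolynomial.C 2 * eu 1 S.mg) := by
  apply cf_ext
  intro i j
  have := S.R1 r i j
  rw [hn, hm] at this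
  simp only [cf_sub, cf_add, cf_C, cf_mon_mul, cf_ug, cf_mg, cf_eu0, cf_eu1, this, m1, m2]
  ring

lemma cas_eq : (10 * MvPolynomial.C (S.a : ℚ) + 18 * MvPolynomial.C (S.b : ℚ)) * S.mg =
    - 2 * MvPolynomial.C (S.a : ℚ) * eu 0 S.mg - 6 * MvPolynomial.C (S.b : ℚ) * eu 1 S.mg
    + 2 * eu 0 (eu 0 S.mg) - 6 * eu 0 (eu 1 S.mg) + 6 * eu 1 (eu 1 S.mg)
    + ((S.ug 0 + mon 1 0 * S.ug 0) + 3 * (S.ug 1 + mon 0 1 * S.ug 1)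
    + (S.ug 2 + mon 1 1 * S.ug 2) + (S.ug 3 + mon 2 1 * S.ug 3) + 3 * (S.ug 4 + mon 3 1 * S.ug 4)
    + 3 * (S.ug 5 + mon 3 2 * S.ug 5)) := by
  have key : MvPolynomial.C (10 * (S.a : ℚ) + 18 * S.b) * S.mg =
    MvPolynomial.C (- 2 * (S.a : ℚ)) * eu 0 S.mg - MvPolynomial.C (6 * (S.b : ℚ)) * eu 1 S.mg
    + MvPolynomial.C 2 * eu 0 (eu 0 S.mg) - MvPolynomial.C 6 * eu 0 (eu 1 S.mg)
    + MvPolynomial.C 6 * eu 1 (eu 1 S.mg)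
    + ((S.ug 0 + mon 1 0 * S.ug 0) + MvPolynomial.C 3 * (S.ug 1 + mon 0 1 * S.ug 1)
    + (S.ug 2 + mon 1 1 * S.ug 2) + (S.ug 3 + mon 2 1 * S.ug 3)
    + MvPolynomial.C 3 * (S.ug 4 + mon 3 1 * S.ug 4)
    + MvPolynomial.C 3 * (S.ug 5 + mon 3 2 * S.ug 5)) := by
    apply cf_ext
    intro i j
    have := S.R2 i j
    simp only [Fin.sum_univ_six, cc, rn, rm, cas, m1, m2, Matrix.cons_val] at this
    simp only [cf_sub, cf_add, cf_C, cf_mon_mul, cf_ug, cf_mg, cf_eu0, cf_eu1]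
    push_cast
    linear_combination this
  have c2 : (MvPolynomial.C 2 : R2v) = 2 := map_ofNat MvPolynomial.C _
  have c3 : (MvPolynomial.C 3 : R2v) = 3 := map_ofNat MvPolynomial.C _
  have c6 : (MvPolynomial.C 6 : R2v) = 6 := map_ofNat MvPolynomial.C _
  have c10 : (MvPolynomial.C 10 : R2v) = 10 := map_ofNat MvPolynomial.C _
  have c18 : (MvPolynomial.C 18 : R2v) = 18 := map_ofNat MvPolynomial.C _
  simp only [map_add, map_mul, map_neg, c2, c3, c6, c10, c18] at key
  exact key

/-- Numerator of the character. -/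
noncomputable def nu : R2v := wd (MvPolynomial.X 0) (MvPolynomial.X 1) * S.mg

lemma nu_eq : 2 * eu 0 (eu 0 S.nu) - 6 * eu 0 (eu 1 S.nu) + 6 * eu 1 (eu 1 S.nu)
      - 2 * (MvPolynomial.C (S.a : ℚ) + 1) * eu 0 S.nu
      - 6 * (MvPolynomial.C (S.b : ℚ) + 1) * eu 1 S.nu = 0 := by
  have u0 := S.ug_eq 0 1 0 rfl rfl
  have u1 := S.ug_eq 1 0 1 rfl rfl
  have u2 := S.ug_eq 2 1 1 rfl rfl
  have u3 := S.ug_eq 3 2 1 rfl rfl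
  have u4 := S.ug_eq 4 3 1 rfl rfl
  have u5 := S.ug_eq 5 3 2 rfl rfl
  have uE := S.cas_eq
  simp only [mon, cx, cy, Matrix.cons_val, pow_zero, pow_one, one_mul, mul_one] at u0 u1 u2 u3 u4 u5 uE
  have c0 : (MvPolynomial.C 0 : R2v) = 0 := by simp
  have c1 : (MvPolynomial.C 1 : R2v) = 1 := by simp
  have c2 : (MvPolynomial.C 2 : R2v) = 2 := map_ofNat MvPolynomial.C _
  have c3 : (MvPolynomial.C 3 : R2v) = 3 := map_ofNat MvPolynomial.C _
  simp only [c0, c1, c2, c3, one_mul, zero_mul, add_zero, zero_add] at u0 u1 u2 u3 u4 u5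
  refine cas_ring (eu 0) (eu 1) (MvPolynomial.X 0) (MvPolynomial.X 1) ?_ ?_ ?_ ?_
    (MvPolynomial.C (S.a : ℚ)) (MvPolynomial.C (S.b : ℚ)) ?_ ?_ S.mg _ _ _ _ _ _
    u0 u1 u2 u3 u4 u5 uE
  all_goals simp [eu]

lemma cf_nu_mul (i j : ℤ) : (S.qq i j : ℚ) * cf S.nu i j = 0 := by
  have key : MvPolynomial.C 2 * eu 0 (eu 0 S.nu) - MvPolynomial.C 6 * eu 0 (eu 1 S.nu)
      + MvPolynomial.C 6 * eu 1 (eu 1 S.nu)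
      - MvPolynomial.C (2 * ((S.a : ℚ) + 1)) * eu 0 S.nu
      - MvPolynomial.C (6 * ((S.b : ℚ) + 1)) * eu 1 S.nu = MvPolynomial.C 0 * S.nu := by
    have := S.nu_eq
    have c0 : (MvPolynomial.C 0 : R2v) = 0 := by simp
    have c1 : (MvPolynomial.C 1 : R2v) = 1 := by simp
    have c2 : (MvPolynomial.C 2 : R2v) = 2 := map_ofNat MvPolynomial.C _
    have c6 : (MvPolynomial.C 6 : R2v) = 6 := map_ofNat MvPolynomial.C _
    simp only [map_add, map_mul, c0, c1, c2, c6, zero_mul]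
    exact this
  have := congrArg (fun f => cf f i j) key
  simp only [cf_sub, cf_add, cf_C, cf_eu0, cf_eu1] at this
  unfold qq
  push_cast
  linear_combination (-1/2) * this

lemma cf_nu (i j : ℤ) : cf S.nu i j = (S.M i j : ℚ) - S.M (i-1) j - S.M i (j-1) + S.M (i-4) (j-1)
    + S.M (i-1) (j-2) - S.M (i-6) (j-2) - S.M (i-4) (j-4) + S.M (i-9) (j-4)
    + S.M (i-6) (j-5) - S.M (i-10) (j-5) - S.M (i-9) (j-6) + S.M (i-10) (j-6) := by
  have : S.nu = S.mg - mon 1 0 * S.mg - mon 0 1 * S.mg + mon 4 1 * S.mg + mon 1 2 * S.mg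
    - mon 6 2 * S.mg - mon 4 4 * S.mg + mon 9 4 * S.mg + mon 6 5 * S.mg - mon 10 5 * S.mg
    - mon 9 6 * S.mg + mon 10 6 * S.mg := by
    simp only [nu, wd, mon]; ring
  rw [this]
  simp only [cf_sub, cf_add, cf_mon_mul, cf_mg]
  simp

lemma d1 (i j : ℤ) : S.M (i-1) j = S.M (S.a + 1 - i + 3 * j) j := by
  rw [S.M_s1]; congr 1; ring
lemma d2 (i j : ℤ) : S.M i (j-1) = S.M i (S.b + 1 + i - j) := by
  rw [S.M_s2]; congr 1; ring
lemma q1 (i j : ℤ) : S.qq (S.a + 1 - i + 3 * j) j = S.qq i j := by unfold qq; ring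
lemma q2 (i j : ℤ) : S.qq i (S.b + 1 + i - j) = S.qq i j := by unfold qq; ring

/-- A shifted multiplicity on the critical quadric is an indicator function. -/
def Tm (n m x y : ℤ) : Prop := ∀ i j : ℤ, S.qq i j = 0 →
  S.M (i - n) (j - m) = if i = x ∧ j = y then 1 else 0

lemma step1 {n m x y : ℤ} (h : S.Tm n m x y) (n' x' : ℤ) (hn : n' = 1 - n + 3 * m)
    (hx : x' = S.a + 1 - x + 3 * y) : S.Tm n' m x' y := by
  intro i j hq
  have := h (S.a + 1 - i + 3 * j) j (by rw [q1, hq])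
  rw [S.M_s1, show S.a - (i - n') + 3 * (j - m) = S.a + 1 - i + 3 * j - n by rw [hn]; ring, this, hx]
  congr 1
  exact propext ⟨fun h => ⟨by omega, h.2⟩, fun h => ⟨by omega, h.2⟩⟩

lemma step2 {n m x y : ℤ} (h : S.Tm n m x y) (m' y' : ℤ) (hn : m' = 1 + n - m)
    (hx : y' = S.b + 1 + x - y) : S.Tm n m' x y' := by
  intro i j hq
  have := h i (S.b + 1 + i - j) (by rw [q2, hq])
  rw [S.M_s2, show S.b + (i - n) - (j - m') = S.b + 1 + i - j - m by rw [hn]; ring, this, hx]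
  congr 1
  exact propext ⟨fun h => ⟨h.1, by omega⟩, fun h => ⟨h.1, by omega⟩⟩

lemma T0 : S.Tm 0 0 0 0 := by
  intro i j hq
  rw [sub_zero, sub_zero, S.M_on i j hq]

/-- The explicit numerator. -/
def nume {A : Type*} [CommRing A] (a b : ℕ) (f : ℕ → ℕ → A) : A :=
  f 0 0 - f a 0 - f 0 b + f (a + 3 * b) b + f a (a + b) - f (3 * a + 3 * b) (a + b)
    - f (a + 3 * b) (a + 3 * b) + f (3 * a + 6 * b) (a + 3 * b) + f (3 * a + 3 * b) (2 * a + 3 * b)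
    - f (4 * a + 6 * b) (2 * a + 3 * b) - f (3 * a + 6 * b) (2 * a + 4 * b)
    + f (4 * a + 6 * b) (2 * a + 4 * b)

lemma cf_nume (a b : ℕ) (i j : ℤ) : cf (nume a b mon) i j =
    nume a b (fun n m => if i = n ∧ j = m then 1 else 0) := by
  simp only [nume, cf_sub, cf_add, cf_mon]

lemma nu_eq_nume : S.nu = nume (S.a + 1) (S.b + 1) mon := by
  apply cf_ext
  intro i j
  rw [cf_nume]
  by_cases hq : S.qq i j = 0
  · have t0 := S.T0
    have t1 := S.step1 t0 1 (S.a + 1 : ℕ) (by norm_num) (by push_cast; ring)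
    have t2 := S.step2 t0 1 (S.b + 1 : ℕ) (by norm_num) (by push_cast; ring)
    have t3 := S.step1 t2 4 (S.a + 1 + 3 * (S.b + 1) : ℕ) (by norm_num) (by push_cast; ring)
    have t4 := S.step2 t1 2 (S.a + 1 + (S.b + 1) : ℕ) (by norm_num) (by push_cast; ring)
    have t5 := S.step1 t4 6 (3 * (S.a + 1) + 3 * (S.b + 1) : ℕ) (by norm_num) (by push_cast; ring)
    have t6 := S.step2 t3 4 (S.a + 1 + 3 * (S.b + 1) : ℕ) (by norm_num) (by push_cast; ring)
    have t7 := S.step1 t6 9 (3 * (S.a + 1) + 6 * (S.b + 1) : ℕ) (by norm_num) (by push_cast; ring)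
    have t8 := S.step2 t5 5 (2 * (S.a + 1) + 3 * (S.b + 1) : ℕ) (by norm_num) (by push_cast; ring)
    have t9 := S.step1 t8 10 (4 * (S.a + 1) + 6 * (S.b + 1) : ℕ) (by norm_num) (by push_cast; ring)
    have t10 := S.step2 t7 6 (2 * (S.a + 1) + 4 * (S.b + 1) : ℕ) (by norm_num) (by push_cast; ring)
    have t11 := S.step1 t10 10 (4 * (S.a + 1) + 6 * (S.b + 1) : ℕ) (by norm_num) (by push_cast; ring)
    have w0 := t0 i j hq
    have w1 := t1 i j hq
    have w2 := t2 i j hq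
    rw [sub_zero] at w0 w1 w2
    rw [sub_zero] at w0
    rw [S.cf_nu, w0, w1, w2, t3 i j hq, t4 i j hq, t5 i j hq, t6 i j hq, t7 i j hq, t8 i j hq,
      t9 i j hq, t10 i j hq, t11 i j hq]
    unfold nume
    push_cast
    rfl
  · have h0 := S.cf_nu_mul i j
    have h1 : cf S.nu i j = 0 := by
      rcases mul_eq_zero.mp h0 with h | h
      · exact absurd (by exact_mod_cast h) hq
      · exact h
    rw [h1]
    have key : ∀ n m : ℕ, S.qq n m = 0 → (if i = n ∧ j = m then (1 : ℚ) else 0) = 0 := by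
      intro n m h
      rw [if_neg]
      rintro ⟨rfl, rfl⟩
      exact hq h
    unfold nume
    beta_reduce
    rw [key, key, key, key, key, key, key, key, key, key, key, key]
    · simp
    all_goals (unfold qq; push_cast; ring)

open Polynomial in
/-- The principal specialization of the character. -/
lemma kap_formula : (∑ k ∈ Finset.range S.N, C (S.kap k : ℚ) * X ^ k) *
      ((1 - X) * (1 - X) * (1 - X ^ 2) * (1 - X ^ 3) * (1 - X ^ 4) * (1 - X ^ 5)) =
    (1 - X ^ (S.a + 1)) * (1 - X ^ (S.b + 1)) * (1 - X ^ (S.a + S.b + 2))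
      * (1 - X ^ (S.a + 2 * S.b + 3)) * (1 - X ^ (S.a + 3 * S.b + 4))
      * (1 - X ^ (2 * S.a + 3 * S.b + 5)) := by
  have key := congrArg (MvPolynomial.aeval (fun _ : Fin 2 => (X : ℚ[X]))) S.nu_eq_nume
  have h1 : MvPolynomial.aeval (fun _ : Fin 2 => (X : ℚ[X])) S.mg =
      ∑ k ∈ Finset.range S.N, C (S.kap k : ℚ) * X ^ k := by
    rw [mg, gf, map_sum]
    refine Finset.sum_congr rfl fun k _ => ?_
    rw [map_sum, kap, Finset.Nat.sum_antidiagonal_eq_sum_range_succ_mk]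
    simp only [map_mul, MvPolynomial.aeval_C, mon, map_pow, MvPolynomial.aeval_X]
    push_cast
    rw [map_sum, Finset.sum_mul]
    refine Finset.sum_congr rfl fun i hi => ?_
    rw [Finset.mem_range] at hi
    rw [← pow_add, show i + (k - i) = k by omega, show ((k - i : ℕ) : ℤ) = k - i by omega]
    rfl
  rw [nu, map_mul, h1] at key
  simp only [wd, nume, mon, map_add, map_sub, map_mul, map_pow, map_one, MvPolynomial.aeval_X] at key
  have : (1 - X) * (1 - X) * (1 - X ^ 2) * (1 - X ^ 3) * (1 - X ^ 4) * (1 - X ^ 5)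
    = 1 - X - X + (X:ℚ[X]) ^ 4 * X + X * X ^ 2 - X ^ 6 * X ^ 2 - X ^ 4 * X ^ 4 + X ^ 9 * X ^ 4 + X ^ 6 * X ^ 5 -
          X ^ 10 * X ^ 5 - X ^ 9 * X ^ 6 + X ^ 10 * X ^ 6 := by ring
  rw [this, mul_comm, key]
  ring

end HW
end G2Uni

namespace G2Uni

/-- The polynomial algebra on two copies of the seven dimensional representation. -/
abbrev TT := MvPolynomial (Fin 7 × Fin 2) ℚ

/-- The derivation attached to a matrix. -/
noncomputable def dA (A : Matrix (Fin 7) (Fin 7) ℤ) : Derivation ℚ TT TT :=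
  MvPolynomial.mkDerivation ℚ (fun p => ∑ i, (A i p.1 : ℚ) • MvPolynomial.X (i, p.2))

lemma dA_X (A : Matrix (Fin 7) (Fin 7) ℤ) (j : Fin 7) (s : Fin 2) :
    dA A (MvPolynomial.X (j, s)) = ∑ i, (A i j : ℚ) • MvPolynomial.X (i, s) := by
  unfold dA; rw [MvPolynomial.mkDerivation_X]

noncomputable def op (A : Matrix (Fin 7) (Fin 7) ℤ) : Module.End ℚ TT := (dA A).toLinearMap

lemma op_apply (A : Matrix (Fin 7) (Fin 7) ℤ) (x : TT) : op A x = dA A x := rfl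

lemma op_add (A B : Matrix (Fin 7) (Fin 7) ℤ) : op (A + B) = op A + op B := by
  have : dA (A + B) = dA A + dA B := by
    apply MvPolynomial.derivation_ext
    rintro ⟨j, s⟩
    simp [dA_X, add_smul, Finset.sum_add_distrib]
  unfold op; rw [this]; rfl

lemma op_smul (c : ℤ) (A : Matrix (Fin 7) (Fin 7) ℤ) : op (c • A) = (c : ℚ) • op A := by
  have : dA (c • A) = (c : ℚ) • dA A := by
    apply MvPolynomial.derivation_ext
    rintro ⟨j, s⟩
    simp only [dA_X, Derivation.smul_apply, Finset.smul_sum, smul_smul, Matrix.smul_apply]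
    simp
  unfold op; rw [this]; rfl

lemma op_comm (A B : Matrix (Fin 7) (Fin 7) ℤ) : op A * op B - op B * op A = op (A * B - B * A) := by
  have : ⁅dA A, dA B⁆ = dA (A * B - B * A) := by
    apply MvPolynomial.derivation_ext
    rintro ⟨j, s⟩
    simp only [Derivation.commutator_apply, dA_X, map_sum, Derivation.map_smul, Finset.smul_sum, smul_smul,
      Matrix.sub_apply, Matrix.mul_apply]
    rw [Finset.sum_comm, Finset.sum_comm (f := fun x x_1 => ((A x j : ℚ) * (B x_1 x : ℚ)) • (MvPolynomial.X (x_1, s) : TT)),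
      ← Finset.sum_sub_distrib]
    refine Finset.sum_congr rfl fun i _ => ?_
    push_cast
    rw [sub_smul, Finset.sum_smul, Finset.sum_smul]
    simp only [mul_comm]
  unfold op
  rw [← this]
  rfl

/-- The matrix with the given list of entries. -/
def mk7 (l : List (Fin 7 × Fin 7 × ℤ)) : Matrix (Fin 7) (Fin 7) ℤ :=
  fun i j => (l.map fun p => if p.1 = i then (if p.2.1 = j then p.2.2 else 0) else 0).sum

lemma op_rel {A B C : Matrix (Fin 7) (Fin 7) ℤ} (h : A * B - B * A = C) :
    op A * op B - op B * op A = op C := by rw [op_comm, h]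

lemma op_rel0 {A B : Matrix (Fin 7) (Fin 7) ℤ} (h : A * B - B * A = 0) :
    op A * op B - op B * op A = 0 := by
  rw [op_comm, h]
  have := op_smul 0 0
  simpa using this

lemma op_rels {A B C : Matrix (Fin 7) (Fin 7) ℤ} (c : ℤ) (h : A * B - B * A = c • C) :
    op A * op B - op B * op A = (c : ℚ) • op C := by rw [op_comm, h, op_smul]

def me0 : Matrix (Fin 7) (Fin 7) ℤ := mk7 [(0,1,1),(2,3,2),(3,4,1),(5,6,1)]
def me1 : Matrix (Fin 7) (Fin 7) ℤ := mk7 [(1,2,1),(4,5,1)]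
def me2 : Matrix (Fin 7) (Fin 7) ℤ := mk7 [(0,2,-1),(1,3,2),(3,5,-1),(4,6,1)]
def me3 : Matrix (Fin 7) (Fin 7) ℤ := mk7 [(0,3,-2),(1,4,1),(2,5,1),(3,6,-1)]
def me4 : Matrix (Fin 7) (Fin 7) ℤ := mk7 [(0,4,-1),(2,6,1)]
def me5 : Matrix (Fin 7) (Fin 7) ℤ := mk7 [(0,5,-1),(1,6,-1)]
def mf0 : Matrix (Fin 7) (Fin 7) ℤ := mk7 [(1,0,1),(3,2,1),(4,3,2),(6,5,1)]
def mf1 : Matrix (Fin 7) (Fin 7) ℤ := mk7 [(2,1,1),(5,4,1)]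
def mf2 : Matrix (Fin 7) (Fin 7) ℤ := mk7 [(2,0,-1),(3,1,1),(5,3,-2),(6,4,1)]
def mf3 : Matrix (Fin 7) (Fin 7) ℤ := mk7 [(3,0,-1),(4,1,1),(5,2,1),(6,3,-2)]
def mf4 : Matrix (Fin 7) (Fin 7) ℤ := mk7 [(4,0,-1),(6,2,1)]
def mf5 : Matrix (Fin 7) (Fin 7) ℤ := mk7 [(5,0,-1),(6,1,-1)]
def mh1 : Matrix (Fin 7) (Fin 7) ℤ := mk7 [(0, 0, 1), (1, 1, -1), (2, 2, 2), (3, 3, 0), (4, 4, -2), (5, 5, 1), (6, 6, -1)]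
def mh2 : Matrix (Fin 7) (Fin 7) ℤ := mk7 [(0, 0, 0), (1, 1, 1), (2, 2, -1), (3, 3, 0), (4, 4, 1), (5, 5, -1), (6, 6, 0)]

/-- The Lie algebra `G₂` acting by derivations. -/
noncomputable def ops7 : G2Ops TT where
  e := ![op me0, op me1, op me2, op me3, op me4, op me5]
  f := ![op mf0, op mf1, op mf2, op mf3, op mf4, op mf5]
  h1 := op mh1
  h2 := op mh2
  hef := by
    have key : ∀ (A B : Matrix (Fin 7) (Fin 7) ℤ) (x y : ℤ), A * B - B * A = x • mh1 + y • mh2 →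
        op A * op B - op B * op A = (x : ℚ) • op mh1 + (y : ℚ) • op mh2 := by
      intro A B x y h
      rw [op_comm, h, op_add, op_smul, op_smul]
    intro r
    fin_cases r
    · simpa [cx, cy] using key me0 mf0 1 0 (by decide +kernel)
    · simpa [cx, cy] using key me1 mf1 0 1 (by decide +kernel)
    · simpa [cx, cy] using key me2 mf2 1 3 (by decide +kernel)
    · simpa [cx, cy] using key me3 mf3 2 3 (by decide +kernel)
    · simpa [cx, cy] using key me4 mf4 1 1 (by decide +kernel)
    · simpa [cx, cy] using key me5 mf5 1 2 (by decide +kernel)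
  e0f1 := op_rel0 (by decide +kernel)
  e1f0 := op_rel0 (by decide +kernel)
  h1f0 := by
    have := op_rels (-2) (A := mh1) (B := mf0) (C := mf0) (by decide +kernel)
    push_cast at this; exact this
  h1f1 := by
    have := op_rels (3) (A := mh1) (B := mf1) (C := mf1) (by decide +kernel)
    push_cast at this; exact this
  h2f0 := by
    have := op_rels (1) (A := mh2) (B := mf0) (C := mf0) (by decide +kernel)
    push_cast at this; exact this
  h2f1 := by
    have := op_rels (-2) (A := mh2) (B := mf1) (C := mf1) (by decide +kernel)
    push_cast at this; exact this
  h1e0 := by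
    have := op_rels (2) (A := mh1) (B := me0) (C := me0) (by decide +kernel)
    push_cast at this; exact this
  h1e1 := by
    have := op_rels (-3) (A := mh1) (B := me1) (C := me1) (by decide +kernel)
    push_cast at this; exact this
  h2e0 := by
    have := op_rels (-1) (A := mh2) (B := me0) (C := me0) (by decide +kernel)
    push_cast at this; exact this
  h2e1 := by
    have := op_rels (2) (A := mh2) (B := me1) (C := me1) (by decide +kernel)
    push_cast at this; exact this
  e2 := op_rel (by decide +kernel)
  e3 := by
    have := op_rels (2) (A := me2) (B := me0) (C := me3) (by decide +kernel)
    push_cast at this; exact this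
  e4 := by
    have := op_rels (3) (A := me3) (B := me0) (C := me4) (by decide +kernel)
    push_cast at this; exact this
  e5 := op_rel (by decide +kernel)
  f2 := op_rel (by decide +kernel)
  f3 := by
    have := op_rels (2) (A := mf0) (B := mf2) (C := mf3) (by decide +kernel)
    push_cast at this; exact this
  f4 := by
    have := op_rels (3) (A := mf0) (B := mf3) (C := mf4) (by decide +kernel)
    push_cast at this; exact this
  f5 := op_rel (by decide +kernel)
  f0f4 := op_rel0 (by decide +kernel)
  f0f5 := op_rel0 (by decide +kernel)
  f1f2 := op_rel0 (by decide +kernel)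
  f1f3 := op_rel0 (by decide +kernel)
  f1f5 := op_rel0 (by decide +kernel)
  f0e2 := by
    have := op_rels (-3) (A := mf0) (B := me2) (C := me1) (by decide +kernel)
    push_cast at this; exact this
  f0e3 := by
    have := op_rels (-2) (A := mf0) (B := me3) (C := me2) (by decide +kernel)
    push_cast at this; exact this
  f0e4 := by
    have := op_rels (-1) (A := mf0) (B := me4) (C := me3) (by decide +kernel)
    push_cast at this; exact this
  f0e5 := op_rel0 (by decide +kernel)
  f1e2 := by
    have := op_rels (1) (A := mf1) (B := me2) (C := me0) (by decide +kernel)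
    push_cast at this; exact this
  f1e3 := op_rel0 (by decide +kernel)
  f1e4 := op_rel0 (by decide +kernel)
  f1e5 := by
    have := op_rels (-1) (A := mf1) (B := me5) (C := me4) (by decide +kernel)
    push_cast at this; exact this

lemma der_sum {ι : Type*} (s : Finset ι) (d : ι → Derivation ℚ TT TT) (p : TT) :
    (∑ i ∈ s, d i) p = ∑ i ∈ s, d i p := by
  have := map_sum (Derivation.coeFnAddMonoidHom (R := ℚ) (A := TT) (M := TT)) d s
  have h2 := congrFun this p
  rw [Finset.sum_apply] at h2
  exact h2

lemma dA_eq (A : Matrix (Fin 7) (Fin 7) ℤ) (p : TT) :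
    dA A p = ∑ i, MvPolynomial.pderiv i p * dA A (MvPolynomial.X i) := by
  have : dA A = ∑ i, (dA A (MvPolynomial.X i)) • MvPolynomial.pderiv i := by
    apply MvPolynomial.derivation_ext
    intro j
    rw [der_sum, Finset.sum_eq_single j]
    · simp
    · intro i _ hij
      simp [MvPolynomial.pderiv_X_of_ne hij.symm]
    · simp
  conv_lhs => rw [this]
  rw [der_sum]
  refine Finset.sum_congr rfl fun i _ => ?_
  rw [Derivation.smul_apply, smul_eq_mul, mul_comm]

lemma dA_hom (A : Matrix (Fin 7) (Fin 7) ℤ) (n : ℕ) (p : TT) (hp : p.IsHomogeneous n) :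
    (dA A p).IsHomogeneous n := by
  rcases Nat.eq_zero_or_pos n with rfl | hn
  · have := MvPolynomial.totalDegree_eq_zero_iff_eq_C.mp (Nat.le_zero.mp hp.totalDegree_le)
    rw [this, MvPolynomial.derivation_C]
    exact MvPolynomial.isHomogeneous_zero _ _ _
  · rw [dA_eq]
    refine MvPolynomial.IsHomogeneous.sum _ _ _ fun i _ => ?_
    have h1 : (MvPolynomial.pderiv i p).IsHomogeneous (n - 1) := hp.pderiv
    have h2 : (dA A (MvPolynomial.X i)).IsHomogeneous 1 := by
      obtain ⟨j, s⟩ := i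
      rw [dA_X]
      refine MvPolynomial.IsHomogeneous.sum _ _ _ fun k _ => ?_
      rw [MvPolynomial.smul_eq_C_mul]
      exact (MvPolynomial.isHomogeneous_X ℚ _).C_mul _
    have := h1.mul h2
    rwa [Nat.sub_add_cancel hn] at this

/-- The basic invariant minor. -/
noncomputable def det2 : TT := MvPolynomial.X (0, 0) * MvPolynomial.X (1, 1)
  - MvPolynomial.X (1, 0) * MvPolynomial.X (0, 1)

/-- Highest weight vectors. -/
noncomputable def hwv (a b : ℕ) : TT := MvPolynomial.X (0, 0) ^ a * det2 ^ b

lemma det2_ne : det2 ≠ 0 := by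
  intro h
  have := congrArg (MvPolynomial.eval (fun p : Fin 7 × Fin 2 => if p.1.val = p.2.val then (1 : ℚ) else 0)) h
  simp [det2] at this

lemma dA_hwv (A : Matrix (Fin 7) (Fin 7) ℤ) (c d : ℚ) (a b : ℕ)
    (h1 : dA A (MvPolynomial.X (0, 0)) = c • MvPolynomial.X (0, 0)) (h2 : dA A det2 = d • det2) :
    dA A (hwv a b) = (a * c + b * d : ℚ) • hwv a b := by
  unfold hwv
  rw [Derivation.leibniz, Derivation.leibniz_pow, Derivation.leibniz_pow, h1, h2]
  simp only [MvPolynomial.smul_eq_C_mul, smul_eq_mul, nsmul_eq_mul, map_add, map_mul, map_natCast]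
  rcases a with _ | a <;> rcases b with _ | b <;> simp [pow_succ] <;> ring

lemma dA_det2 (A : Matrix (Fin 7) (Fin 7) ℤ) (c c' d : ℚ)
    (h1 : ∀ s, dA A (MvPolynomial.X (0, s)) = c • MvPolynomial.X (0, s))
    (h2 : ∀ s, dA A (MvPolynomial.X (1, s)) = c' • MvPolynomial.X (1, s) + d • MvPolynomial.X (0, s)) :
    dA A det2 = (c + c') • det2 := by
  unfold det2
  rw [map_sub, Derivation.leibniz, Derivation.leibniz, h1, h2, h1, h2]
  simp only [MvPolynomial.smul_eq_C_mul, smul_eq_mul, map_add]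
  ring

/-- The highest weight module with highest weight `(a, b)`. -/
noncomputable def hw (a b : ℕ) : HW TT where
  O := ops7
  v := hwv a b
  a := a
  b := b
  hv := mul_ne_zero (pow_ne_zero _ (MvPolynomial.X_ne_zero _)) (pow_ne_zero _ det2_ne)
  e0v := by
    change dA me0 _ = 0
    have h0 : ∀ s, dA me0 (MvPolynomial.X (0, s)) = (0 : ℚ) • MvPolynomial.X (0, s) := by
      intro s; rw [dA_X]; simp [me0, mk7]
    rw [dA_hwv me0 0 (0 + 0) a b (h0 _) (dA_det2 _ 0 0 1 h0 ?_)]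
    · simp
    · intro s; rw [dA_X]; simp [me0, mk7]
  e1v := by
    change dA me1 _ = 0
    have h0 : ∀ s, dA me1 (MvPolynomial.X (0, s)) = (0 : ℚ) • MvPolynomial.X (0, s) := by
      intro s; rw [dA_X]; simp [me1, mk7]
    rw [dA_hwv me1 0 (0 + 0) a b (h0 _) (dA_det2 _ 0 0 0 h0 ?_)]
    · simp
    · intro s; rw [dA_X]; simp [me1, mk7]
  h1v := by
    change dA mh1 _ = _
    have h0 : ∀ s, dA mh1 (MvPolynomial.X (0, s)) = (1 : ℚ) • MvPolynomial.X (0, s) := by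
      intro s; rw [dA_X]; simp [mh1, mk7]
    rw [dA_hwv mh1 1 (1 + (-1)) a b (h0 _) (dA_det2 _ 1 (-1) 0 h0 ?_)]
    · simp
    · intro s; rw [dA_X]; simp [mh1, mk7]
  h2v := by
    change dA mh2 _ = _
    have h0 : ∀ s, dA mh2 (MvPolynomial.X (0, s)) = (0 : ℚ) • MvPolynomial.X (0, s) := by
      intro s; rw [dA_X]; simp [mh2, mk7]
    rw [dA_hwv mh2 0 (0 + 1) a b (h0 _) (dA_det2 _ 0 1 0 h0 ?_)]
    · simp
    · intro s; rw [dA_X]; simp [mh2, mk7]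
  D := MvPolynomial.homogeneousSubmodule (Fin 7 × Fin 2) ℚ (a + 2 * b)
  hD := Module.Finite.iff_fg.mpr (MvPolynomial.homogeneousSubmodule_fg _ _ _)
  vD := by
    rw [MvPolynomial.mem_homogeneousSubmodule]
    unfold hwv
    refine MvPolynomial.IsHomogeneous.mul ?_ ?_
    · simpa using (MvPolynomial.isHomogeneous_X ℚ ((0, 0) : Fin 7 × Fin 2)).pow a
    · refine MvPolynomial.IsHomogeneous.pow ?_ b
      exact ((MvPolynomial.isHomogeneous_X ℚ _).mul (MvPolynomial.isHomogeneous_X ℚ _)).sub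
        ((MvPolynomial.isHomogeneous_X ℚ _).mul (MvPolynomial.isHomogeneous_X ℚ _))
  f0D := fun x hx => dA_hom _ _ _ hx
  f1D := fun x hx => dA_hom _ _ _ hx

end G2Uni

namespace G2Uni
variable {P : Type} [PartialOrder P] [Fintype P]

lemma le_rtg {u v : P} (h : u ≤ v) : Relation.ReflTransGen (· ⋖ ·) u v := by
  let _ : LocallyFiniteOrder P := Fintype.toLocallyFiniteOrder
  exact le_iff_reflTransGen_covBy.mp h

/-- One can go from an ideal to a larger one by adding one vertex at a time. -/
lemma climb (s t : Finset P) (hs : IsIdeal s) (ht : IsIdeal t) (hst : s ⊆ t)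
    (Q : Finset P → Prop) (h0 : Q s)
    (hstep : ∀ x u, IsIdeal x → IsIdeal (insert u x) → s ⊆ x → u ∈ t → u ∉ x → Q x →
      Q (insert u x)) : Q t := by
  have main : ∀ n : ℕ, ∀ x : Finset P, IsIdeal x → s ⊆ x → x ⊆ t → Q x → (t \ x).card = n → Q t := by
    intro n
    induction n with
    | zero =>
      intro x _ _ hxt hQ hn
      have : t ⊆ x := Finset.sdiff_eq_empty_iff_subset.mp (Finset.card_eq_zero.mp hn)
      rwa [Finset.Subset.antisymm this hxt]
    | succ n ih =>
      intro x hx hsx hxt hQ hn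
      have hne : (t \ x).Nonempty := by
        rw [← Finset.card_pos]; omega
      obtain ⟨u, hu⟩ := (t \ x).exists_minimal hne
      have hut : u ∈ t := (Finset.mem_sdiff.mp hu.1).1
      have hux : u ∉ x := (Finset.mem_sdiff.mp hu.1).2
      have hid : IsIdeal (insert u x) := by
        intro y hy z hz
        rcases Finset.mem_insert.mp hy with rfl | hy
        · by_cases hzx : z ∈ x
          · exact Finset.mem_insert_of_mem hzx
          · have hzt : z ∈ t := ht hut hz
            have := hu.2 (Finset.mem_sdiff.mpr ⟨hzt, hzx⟩) hz
            rw [le_antisymm hz this]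
            exact Finset.mem_insert_self _ _
        · exact Finset.mem_insert_of_mem (hx hy hz)
      refine ih (insert u x) hid (hsx.trans (Finset.subset_insert _ _))
        (Finset.insert_subset hut hxt) (hstep x u hx hid hsx hut hux hQ) ?_
      rw [Finset.sdiff_insert, Finset.card_erase_of_mem hu.1, hn]
      rfl
  exact main _ s hs (Finset.Subset.refl _) hst h0 rfl

variable (G : GridData P)

lemma rtg_le {u v : P} (h : Relation.ReflTransGen (· ⋖ ·) u v) : u ≤ v := by
  induction h with
  | refl => exact le_refl _
  | @tail x y _ hxy ih => exact ih.trans hxy.le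

lemma chain_le (hG : G.IsTwoColorGridPoset) {u v : P} (h : u ≤ v) : G.chain v ≤ G.chain u := by
  have h' := le_rtg h
  clear h
  induction h' with
  | refl => exact le_refl _
  | @tail b c hb hbc ih =>
    have := hG.1.2.2.2.2 _ _ hbc
    omega

lemma chain_step (hG : G.IsTwoColorGridPoset) {u v : P} (h : u ≤ v)
    (hc : G.chain v < G.chain u) :
    ∃ w, u ≤ w ∧ w ≤ v ∧ G.chain w + 1 = G.chain u ∧ G.color w ≠ G.color u := by
  have h' := le_rtg h
  clear h
  induction h' using Relation.ReflTransGen.head_induction_on with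
  | refl => omega
  | @head a c hac hcv ih =>
    rcases hG.1.2.2.2.2 _ _ hac with h1 | h1
    · obtain ⟨w, h2, h3, h4, h5⟩ := ih (by omega)
      refine ⟨w, hac.le.trans h2, h3, by omega, ?_⟩
      rw [hG.2.1 _ _ h1]; exact h5
    · exact ⟨c, hac.le, rtg_le hcv, h1.symm,
        (hG.2.2 _ _ (Relation.ReflTransGen.single (Or.inl hac)) h1).symm⟩

end G2Uni

namespace G2Uni
variable {P : Type} [PartialOrder P] [Fintype P]
variable (G : GridData P)

/-- The smallest ideal with the same vertices of the other color. -/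
noncomputable def lo (γ : Fin 2) (t : Finset P) : Finset P :=
  Finset.univ.filter (fun u => ∃ w ∈ t, G.color w ≠ γ ∧ u ≤ w)

/-- The largest ideal with the same vertices of the other color. -/
noncomputable def hi (γ : Fin 2) (t : Finset P) : Finset P :=
  Finset.univ.filter (fun u => ∀ w ≤ u, G.color w ≠ γ → w ∈ t)

lemma mem_lo {γ : Fin 2} {t : Finset P} {u : P} :
    u ∈ lo G γ t ↔ ∃ w ∈ t, G.color w ≠ γ ∧ u ≤ w := by simp [lo]

lemma mem_hi {γ : Fin 2} {t : Finset P} {u : P} :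
    u ∈ hi G γ t ↔ ∀ w ≤ u, G.color w ≠ γ → w ∈ t := by simp [hi]

lemma lo_ideal (γ : Fin 2) (t : Finset P) : IsIdeal (lo G γ t) := by
  intro x hx y hy
  rw [mem_lo] at hx ⊢
  obtain ⟨w, h1, h2, h3⟩ := hx
  exact ⟨w, h1, h2, hy.trans h3⟩

lemma hi_ideal (γ : Fin 2) (t : Finset P) : IsIdeal (hi G γ t) := by
  intro x hx y hy
  rw [mem_hi] at hx ⊢
  intro w hw
  exact hx w (hw.trans hy)

lemma lo_sub {γ : Fin 2} {t : Finset P} (ht : IsIdeal t) : lo G γ t ⊆ t := by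
  intro x hx
  rw [mem_lo] at hx
  obtain ⟨w, h1, h2, h3⟩ := hx
  exact ht h1 h3

lemma sub_hi {γ : Fin 2} {t : Finset P} (ht : IsIdeal t) : t ⊆ hi G γ t := by
  intro x hx
  rw [mem_hi]
  intro w hw _
  exact ht hx hw

lemma color_F {γ : Fin 2} {t : Finset P} {u : P} (h1 : u ∈ hi G γ t) (h2 : u ∉ lo G γ t) :
    G.color u = γ := by
  by_contra h
  exact h2 ((mem_lo G).mpr ⟨u, (mem_hi G).mp h1 u le_rfl h, h, le_rfl⟩)

/-- Same vertices of the other color. -/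
def Sim (γ : Fin 2) (s t : Finset P) : Prop := ∀ w, G.color w ≠ γ → (w ∈ s ↔ w ∈ t)

variable {G}

lemma Sim.symm {γ : Fin 2} {s t : Finset P} (h : Sim G γ s t) : Sim G γ t s :=
  fun w hw => (h w hw).symm

lemma Sim.trans {γ : Fin 2} {s t r : Finset P} (h : Sim G γ s t) (h' : Sim G γ t r) : Sim G γ s r :=
  fun w hw => (h w hw).trans (h' w hw)

lemma Sim.lo {γ : Fin 2} {s t : Finset P} (h : Sim G γ s t) : lo G γ s = lo G γ t := by
  ext u
  rw [mem_lo, mem_lo]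
  constructor
  · rintro ⟨w, h1, h2, h3⟩
    exact ⟨w, (h w h2).mp h1, h2, h3⟩
  · rintro ⟨w, h1, h2, h3⟩
    exact ⟨w, (h w h2).mpr h1, h2, h3⟩

lemma Sim.hi {γ : Fin 2} {s t : Finset P} (h : Sim G γ s t) : hi G γ s = hi G γ t := by
  ext u
  rw [mem_hi, mem_hi]
  constructor
  · intro h1 w hw h2
    exact (h w h2).mp (h1 w hw h2)
  · intro h1 w hw h2
    exact (h w h2).mpr (h1 w hw h2)

lemma sim_lo {γ : Fin 2} {t : Finset P} (ht : IsIdeal t) : Sim G γ (lo G γ t) t := by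
  intro w hw
  exact ⟨fun h => lo_sub G ht h, fun h => (mem_lo G).mpr ⟨w, h, hw, le_rfl⟩⟩

lemma sim_hi {γ : Fin 2} {t : Finset P} (ht : IsIdeal t) : Sim G γ (hi G γ t) t := by
  intro w hw
  exact ⟨fun h => (mem_hi G).mp h w le_rfl hw, fun h => sub_hi G ht h⟩

lemma reach {γ : Fin 2} {s t : Finset P} (hs : IsIdeal s) (ht : IsIdeal t) (hst : s ⊆ t)
    (h : Sim G γ s t) : Relation.ReflTransGen (G.GStep γ) s t ∧
      Relation.ReflTransGen (G.GStep γ) t s := by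
  refine climb s t hs ht hst (fun x => Relation.ReflTransGen (G.GStep γ) s x ∧
      Relation.ReflTransGen (G.GStep γ) x s) ⟨.refl, .refl⟩ ?_
  rintro x u hx hux hsx hut hu ⟨h1, h2⟩
  have hc : G.color u = γ := by
    by_contra hc
    exact hu (hsx ((h u hc).mpr hut))
  constructor
  · exact h1.tail ⟨hx, hux, u, hc, Or.inl ⟨hu, rfl⟩⟩
  · exact Relation.ReflTransGen.head ⟨hux, hx, u, hc, Or.inr ⟨hu, rfl⟩⟩ h2

lemma comp_sim {γ : Fin 2} {s t : Finset P} (ht : IsIdeal t) (h : s ∈ G.comp γ t) :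
    IsIdeal s ∧ Sim G γ s t := by
  have h' : Relation.ReflTransGen (G.GStep γ) t s := h
  clear h
  induction h' with
  | refl => exact ⟨ht, fun _ _ => Iff.rfl⟩
  | @tail b c _ hbc ih =>
    obtain ⟨_, hc, u, hu, h1⟩ := hbc
    refine ⟨hc, fun w hw => ?_⟩
    rw [← ih.2 w hw]
    have hwu : w ≠ u := by rintro rfl; exact hw hu
    rcases h1 with ⟨_, rfl⟩ | ⟨_, rfl⟩ <;> simp [hwu]

lemma mcoord_eq {γ : Fin 2} {t : Finset P} (ht : IsIdeal t) :
    G.mcoord γ t = 2 * (t.card : ℤ) - (lo G γ t).card - (hi G γ t).card := by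
  have hmin : G.minCard γ t = (lo G γ t).card := by
    unfold GridData.minCard
    apply le_antisymm
    · exact Nat.sInf_le ⟨_, (reach (lo_ideal G γ t) ht (lo_sub G ht) (sim_lo ht)).2, rfl⟩
    · refine le_csInf ⟨_, t, Relation.ReflTransGen.refl, rfl⟩ ?_
      rintro _ ⟨s, hs, rfl⟩
      obtain ⟨h1, h2⟩ := comp_sim ht hs
      rw [← h2.lo]
      exact Finset.card_le_card (lo_sub G h1)
  have hmax : G.maxCard γ t = (hi G γ t).card := by
    unfold GridData.maxCard
    have hub : ∀ n ∈ Finset.card '' G.comp γ t, n ≤ (hi G γ t).card := by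
      rintro _ ⟨s, hs, rfl⟩
      obtain ⟨h1, h2⟩ := comp_sim ht hs
      rw [← h2.hi]
      exact Finset.card_le_card (sub_hi G h1)
    apply le_antisymm
    · exact csSup_le ⟨_, t, Relation.ReflTransGen.refl, rfl⟩ hub
    · exact le_csSup ⟨_, hub⟩
        ⟨_, (reach ht (hi_ideal G γ t) (sub_hi G ht) (sim_hi ht).symm).1, rfl⟩
  unfold GridData.mcoord
  rw [hmin, hmax]; ring

lemma wt_apply (γ : Fin 2) (t : Finset P) : G.wt t γ = G.mcoord γ t := by
  fin_cases γ <;> rfl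

lemma wt_up {M : Matrix (Fin 2) (Fin 2) ℤ} (hM : G.MStructured M) {γ : Fin 2} {s t : Finset P}
    (hs : IsIdeal s) (ht : IsIdeal t) (hst : s ⊆ t) (h : Sim G γ s t) :
    G.wt t = G.wt s + ((t.card : ℤ) - s.card) • M γ := by
  refine climb s t hs ht hst (fun x => G.wt x = G.wt s + ((x.card : ℤ) - s.card) • M γ) (by simp) ?_
  intro x u hx hux hsx hut hu h1
  have hc : G.color u = γ := by
    by_contra hc
    exact hu (hsx ((h u hc).mpr hut))
  rw [← hM x _ hx hux u hu rfl, h1, hc, Finset.card_insert_of_notMem hu]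
  push_cast
  module

lemma wt_sim {M : Matrix (Fin 2) (Fin 2) ℤ} (hM : G.MStructured M) {γ : Fin 2} {s t : Finset P}
    (hs : IsIdeal s) (ht : IsIdeal t) (h : Sim G γ s t) :
    G.wt t = G.wt s + ((t.card : ℤ) - s.card) • M γ := by
  rw [wt_up hM (lo_ideal G γ t) ht (lo_sub G ht) (sim_lo ht),
    wt_up hM (lo_ideal G γ s) hs (lo_sub G hs) (sim_lo hs), h.lo]
  module

end G2Uni

namespace G2Uni
variable {P : Type} [PartialOrder P] [Fintype P]
variable {G : GridData P}

lemma init_seg (A B : Finset P) (tot : ∀ u ∈ A, ∀ v ∈ A, u ≤ v ∨ v ≤ u) (hBA : B ⊆ A)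
    (low : ∀ b ∈ B, ∀ a ∈ A, a ≤ b → a ∈ B) (u : P) (hu : u ∈ A) :
    u ∈ B ↔ (A.filter (· < u)).card < B.card := by
  constructor
  · intro h
    refine Finset.card_lt_card ((Finset.ssubset_iff_of_subset ?_).mpr ⟨u, h, by simp⟩)
    intro v hv
    rw [Finset.mem_filter] at hv
    exact low u h v hv.1 hv.2.le
  · intro h
    by_contra hB
    apply absurd h
    rw [not_lt]
    apply Finset.card_le_card
    intro v hv
    rw [Finset.mem_filter]
    refine ⟨hBA hv, ?_⟩
    rcases tot u hu v (hBA hv) with h1 | h1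
    · exact absurd (low v hv u hu h1) hB
    · refine lt_of_le_of_ne h1 ?_
      rintro rfl
      exact hB hv

lemma card_rank (A : Finset P) (tot : ∀ u ∈ A, ∀ v ∈ A, u ≤ v ∨ v ≤ u) (k : ℕ) :
    (A.filter (fun u => (A.filter (· < u)).card < k)).card = min k A.card := by
  set r : P → ℕ := fun u => (A.filter (· < u)).card with hr
  have mono : ∀ u ∈ A, ∀ v ∈ A, u < v → r u < r v := by
    intro u hu v hv huv
    refine Finset.card_lt_card ((Finset.ssubset_iff_of_subset ?_).mpr ⟨u, by simp [hu, huv], by simp⟩)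
    intro w hw
    rw [Finset.mem_filter] at hw ⊢
    exact ⟨hw.1, hw.2.trans huv⟩
  have inj : Set.InjOn r A := by
    intro u hu v hv h
    by_contra hne
    rcases tot u hu v hv with h1 | h1
    · have := mono u hu v hv (lt_of_le_of_ne h1 hne); omega
    · have := mono v hv u hu (lt_of_le_of_ne h1 (Ne.symm hne)); omega
  have him : A.image r = Finset.range A.card := by
    apply Finset.eq_of_subset_of_card_le
    · intro n hn
      obtain ⟨u, hu, rfl⟩ := Finset.mem_image.mp hn
      rw [Finset.mem_range]
      exact Finset.card_lt_card ((Finset.ssubset_iff_of_subset (Finset.filter_subset _ _)).mpr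
        ⟨u, hu, by simp⟩)
    · rw [Finset.card_range, Finset.card_image_of_injOn inj]
  have h1 : ((A.image r).filter (· < k)).card = (A.filter (fun u => r u < k)).card := by
    rw [Finset.filter_image, Finset.card_image_of_injOn]
    exact inj.mono (by intro x hx; simp at hx; exact hx.1)
  rw [← h1, him]
  have : (Finset.range A.card).filter (· < k) = Finset.range (min k A.card) := by
    ext n; simp; omega
  rw [this, Finset.card_range]

variable (G)

/-- The part of the free vertices in chain `i`. -/
noncomputable def Fc (γ : Fin 2) (t : Finset P) (i : ℕ) : Finset P :=
  (hi G γ t \ lo G γ t).filter (fun u => G.chain u = i)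

/-- Generalized reflection. -/
noncomputable def rfn (γ : Fin 2) (δ : ℕ → ℕ) (t : Finset P) : Finset P :=
  (hi G γ t).filter (fun u => u ∈ lo G γ t ∨
    ((Fc G γ t (G.chain u)).filter (· < u)).card + δ (G.chain u) <
      ((Fc G γ t (G.chain u)).filter (· ∉ t)).card)

variable {G}

lemma mem_Fc {γ : Fin 2} {t : Finset P} {i : ℕ} {u : P} :
    u ∈ Fc G γ t i ↔ u ∈ hi G γ t ∧ u ∉ lo G γ t ∧ G.chain u = i := by
  simp [Fc, and_assoc]

lemma F_chain (hG : G.IsTwoColorGridPoset) {γ : Fin 2} {t : Finset P} {u v : P} (hv : v ∈ hi G γ t)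
    (hu : u ∉ lo G γ t) (huv : u ≤ v) : G.chain u = G.chain v := by
  by_contra hne
  have h1 := chain_le G hG huv
  obtain ⟨w, h2, h3, h4, h5⟩ := chain_step G hG huv (by omega)
  have hcu : G.color u = γ := color_F G (hi_ideal G γ t hv huv) hu
  rw [hcu] at h5
  exact hu ((mem_lo G).mpr ⟨w, (mem_hi G).mp hv w h3 h5, h5, h2⟩)

lemma Fc_tot (hG : G.IsTwoColorGridPoset) {γ : Fin 2} {t : Finset P} {i : ℕ} :
    ∀ u ∈ Fc G γ t i, ∀ v ∈ Fc G γ t i, u ≤ v ∨ v ≤ u := by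
  intro u hu v hv
  exact hG.1.2.2.2.1 u v ((mem_Fc.mp hu).2.2.trans (mem_Fc.mp hv).2.2.symm)

lemma rfn_ideal (hG : G.IsTwoColorGridPoset) (γ : Fin 2) (δ : ℕ → ℕ) (t : Finset P) :
    IsIdeal (rfn G γ δ t) := by
  intro u hu y hy
  rw [rfn, Finset.mem_filter] at hu ⊢
  have hyh := hi_ideal G γ t hu.1 hy
  refine ⟨hyh, ?_⟩
  by_cases hyl : y ∈ lo G γ t
  · exact Or.inl hyl
  · right
    rcases hu.2 with h | h
    · exact absurd (lo_ideal G γ t h hy) hyl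
    · rw [F_chain hG hu.1 hyl hy]
      refine lt_of_le_of_lt (Nat.add_le_add_right (Finset.card_le_card ?_) _) h
      intro v hv
      rw [Finset.mem_filter] at hv ⊢
      exact ⟨hv.1, hv.2.trans_le hy⟩

lemma lo_rfn {γ : Fin 2} {δ : ℕ → ℕ} {t : Finset P} (ht : IsIdeal t) : lo G γ t ⊆ rfn G γ δ t := by
  intro u hu
  rw [rfn, Finset.mem_filter]
  exact ⟨sub_hi G ht (lo_sub G ht hu), Or.inl hu⟩

lemma rfn_hi {γ : Fin 2} {δ : ℕ → ℕ} {t : Finset P} : rfn G γ δ t ⊆ hi G γ t :=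
  Finset.filter_subset _ _

lemma rfn_sim {γ : Fin 2} {δ : ℕ → ℕ} {t : Finset P} (ht : IsIdeal t) :
    Sim G γ (rfn G γ δ t) t := by
  intro w hw
  constructor
  · intro h
    exact (mem_hi G).mp (rfn_hi h) w le_rfl hw
  · intro h
    exact lo_rfn ht ((sim_lo ht w hw).mpr h)

lemma Fc_sim {γ : Fin 2} {s t : Finset P} (h : Sim G γ s t) (i : ℕ) : Fc G γ s i = Fc G γ t i := by
  rw [Fc, Fc, h.lo, h.hi]

lemma card_in (hG : G.IsTwoColorGridPoset) {γ : Fin 2} {δ : ℕ → ℕ} {t : Finset P} (i : ℕ) :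
    ((Fc G γ t i).filter (· ∈ rfn G γ δ t)).card = ((Fc G γ t i).filter (· ∉ t)).card - δ i := by
  have : (Fc G γ t i).filter (· ∈ rfn G γ δ t) = (Fc G γ t i).filter (fun u =>
      ((Fc G γ t i).filter (· < u)).card < ((Fc G γ t i).filter (· ∉ t)).card - δ i) := by
    apply Finset.filter_congr
    intro u hu
    obtain ⟨h1, h2, h3⟩ := mem_Fc.mp hu
    rw [rfn, Finset.mem_filter, h3]
    simp only [h1, h2, true_and, false_or]
    omega
  rw [this, card_rank _ (Fc_tot hG), min_eq_left]
  exact (Nat.sub_le _ _).trans (Finset.card_filter_le _ _)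

lemma card_split {γ : Fin 2} {t s : Finset P} (i : ℕ) :
    ((Fc G γ t i).filter (· ∈ s)).card + ((Fc G γ t i).filter (· ∉ s)).card = (Fc G γ t i).card :=
  Finset.card_filter_add_card_filter_not _

lemma card_out (hG : G.IsTwoColorGridPoset) {γ : Fin 2} {δ : ℕ → ℕ} {t : Finset P} (i : ℕ)
    (hδ : δ i ≤ ((Fc G γ t i).filter (· ∉ t)).card) :
    ((Fc G γ t i).filter (· ∉ rfn G γ δ t)).card = ((Fc G γ t i).filter (· ∈ t)).card + δ i := by
  have h1 := card_in hG (δ := δ) (γ := γ) (t := t) i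
  have h2 := card_split (G := G) (γ := γ) (t := t) (s := t) i
  have h3 := card_split (G := G) (γ := γ) (t := t) (s := rfn G γ δ t) i
  omega

lemma rfn_rfn (hG : G.IsTwoColorGridPoset) {γ : Fin 2} {δ : ℕ → ℕ} {t : Finset P} (ht : IsIdeal t)
    (hδ : ∀ i, δ i ≤ ((Fc G γ t i).filter (· ∉ t)).card) :
    rfn G γ δ (rfn G γ δ t) = t := by
  have hsim : Sim G γ (rfn G γ δ t) t := rfn_sim ht
  ext u
  conv_lhs => rw [rfn]
  rw [Finset.mem_filter, hsim.lo, hsim.hi, Fc_sim hsim, card_out hG _ (hδ _)]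
  by_cases hl : u ∈ lo G γ t
  · simp only [hl, true_or, and_true]
    exact ⟨fun _ => lo_sub G ht hl, fun h => sub_hi G ht h⟩
  · by_cases hh : u ∈ hi G γ t
    · simp only [hl, hh, false_or, true_and]
      have hu : u ∈ Fc G γ t (G.chain u) := mem_Fc.mpr ⟨hh, hl, rfl⟩
      have := init_seg (Fc G γ t (G.chain u)) ((Fc G γ t (G.chain u)).filter (· ∈ t)) (Fc_tot hG)
        (Finset.filter_subset _ _) (by
          intro b hb a ha hab
          rw [Finset.mem_filter] at hb ⊢
          exact ⟨ha, ht hb.2 hab⟩) u hu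
      rw [Finset.mem_filter] at this
      simp only [hu, true_and] at this
      rw [this]; omega
    · simp only [hh, false_and, false_iff]
      exact fun h => hh (sub_hi G ht h)

lemma card_of_sim {γ : Fin 2} {t s : Finset P} (h1 : lo G γ t ⊆ s) (h2 : s ⊆ hi G γ t) :
    s.card = (lo G γ t).card + ∑ i ∈ Finset.univ.image G.chain, ((Fc G γ t i).filter (· ∈ s)).card := by
  have e1 : (s \ lo G γ t).card = ∑ i ∈ Finset.univ.image G.chain,
      ((Fc G γ t i).filter (· ∈ s)).card := by
    rw [Finset.card_eq_sum_card_fiberwise (f := G.chain) (t := Finset.univ.image G.chain)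
      (by intro x _; simp)]
    refine Finset.sum_congr rfl fun i _ => ?_
    congr 1
    ext u
    simp only [Finset.mem_filter, Finset.mem_sdiff, mem_Fc]
    have := @h2 u
    tauto
  rw [← e1, Finset.card_sdiff_of_subset h1]
  have := Finset.card_le_card h1
  omega

lemma card_rfn (hG : G.IsTwoColorGridPoset) {γ : Fin 2} {δ : ℕ → ℕ} {t : Finset P} (ht : IsIdeal t)
    (hδ : ∀ i, δ i ≤ ((Fc G γ t i).filter (· ∉ t)).card) :
    ((rfn G γ δ t).card : ℤ) = t.card - G.mcoord γ t - ∑ i ∈ Finset.univ.image G.chain, (δ i : ℤ) := by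
  rw [mcoord_eq ht]
  have h1 := card_of_sim (G := G) (γ := γ) (t := t) (lo_sub G ht) (sub_hi G ht)
  have h2 := card_of_sim (G := G) (γ := γ) (t := t) ((lo_sub G ht).trans (sub_hi G ht)) (Finset.Subset.refl _)
  have h3 := card_of_sim (G := G) (γ := γ) (t := t) (lo_rfn (δ := δ) ht) rfn_hi
  have h4 : ∑ i ∈ Finset.univ.image G.chain, ((Fc G γ t i).filter (· ∈ rfn G γ δ t)).card
      + ∑ i ∈ Finset.univ.image G.chain, δ i + ∑ i ∈ Finset.univ.image G.chain, ((Fc G γ t i).filter (· ∈ t)).card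
      = ∑ i ∈ Finset.univ.image G.chain, ((Fc G γ t i).filter (· ∈ hi G γ t)).card := by
    rw [← Finset.sum_add_distrib, ← Finset.sum_add_distrib]
    refine Finset.sum_congr rfl fun i _ => ?_
    have h5 := card_in hG (δ := δ) (γ := γ) (t := t) i
    have h6 := card_split (G := G) (γ := γ) (t := t) (s := t) i
    have h7 : (Fc G γ t i).filter (· ∈ hi G γ t) = Fc G γ t i :=
      Finset.filter_true_of_mem fun u hu => (mem_Fc.mp hu).1
    rw [h7]
    have := hδ i
    omega
  rw [← Nat.cast_sum]
  omega

lemma wt_rfn (hG : G.IsTwoColorGridPoset) {M : Matrix (Fin 2) (Fin 2) ℤ} (hM : G.MStructured M)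
    {γ : Fin 2} {δ : ℕ → ℕ} {t : Finset P} (ht : IsIdeal t)
    (hδ : ∀ i, δ i ≤ ((Fc G γ t i).filter (· ∉ t)).card) :
    G.wt (rfn G γ δ t) = G.wt t - (G.wt t γ + ∑ i ∈ Finset.univ.image G.chain, (δ i : ℤ)) • M γ := by
  rw [wt_sim hM ht (rfn_ideal hG γ δ t) (rfn_sim ht).symm, card_rfn hG ht hδ, wt_apply]
  module

end G2Uni

namespace G2Uni
variable {P : Type} [PartialOrder P] [Fintype P]

/-- The set of all order ideals. -/
noncomputable def Ids (P : Type) [PartialOrder P] [Fintype P] : Finset (Finset P) :=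
  Finset.univ.filter (fun t : Finset P => IsIdeal t)

lemma mem_Ids {t : Finset P} : t ∈ Ids P ↔ IsIdeal t := by simp [Ids]

lemma univ_ideal : IsIdeal (Finset.univ : Finset P) := fun _ _ _ _ => Finset.mem_univ _
lemma empty_ideal : IsIdeal (∅ : Finset P) := fun _ h => absurd h (Finset.notMem_empty _)

variable {G : GridData P} {M : Matrix (Fin 2) (Fin 2) ℤ}

lemma wt_univ_nonneg (γ : Fin 2) : 0 ≤ G.wt Finset.univ γ := by
  rw [wt_apply, mcoord_eq univ_ideal]
  have h1 := Finset.card_le_univ (lo G γ (Finset.univ))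
  have h2 := Finset.card_le_univ (hi G γ (Finset.univ))
  rw [Finset.card_univ]
  omega

lemma exists_refl (hG : G.IsTwoColorGridPoset) (hM : G.MStructured M) (γ : Fin 2) {t : Finset P}
    (ht : IsIdeal t) : ∃ s, IsIdeal s ∧ G.wt s = G.wt t - G.wt t γ • M γ := by
  refine ⟨rfn G γ (fun _ => 0) t, rfn_ideal hG _ _ _, ?_⟩
  rw [wt_rfn hG hM ht (by simp)]
  simp

lemma sum_refl (hG : G.IsTwoColorGridPoset) (hM : G.MStructured M) (γ : Fin 2) {R : Type*}
    [AddCommMonoid R] (g : (Fin 2 → ℤ) → R) :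
    ∑ t ∈ Ids P, g (G.wt t) = ∑ t ∈ Ids P, g (G.wt t - G.wt t γ • M γ) := by
  symm
  refine Finset.sum_nbij' (rfn G γ (fun _ => 0)) (rfn G γ (fun _ => 0)) ?_ ?_ ?_ ?_ ?_
  · intro t _; exact mem_Ids.mpr (rfn_ideal hG _ _ _)
  · intro t _; exact mem_Ids.mpr (rfn_ideal hG _ _ _)
  · intro t ht; exact rfn_rfn hG (mem_Ids.mp ht) (by simp)
  · intro t ht; exact rfn_rfn hG (mem_Ids.mp ht) (by simp)
  · intro t ht
    rw [wt_rfn hG hM (mem_Ids.mp ht) (by simp)]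
    simp

/-- Indicator of a chain. -/
def ind (j : ℕ) : ℕ → ℕ := fun i => if i = j then 1 else 0

lemma chain_hi (hG : G.IsTwoColorGridPoset) {t : Finset P} {u : P}
    (hm : ∀ v, v ∉ t → G.chain v ≤ G.chain u) {x : P} (hx : G.chain x = G.chain u) :
    x ∈ hi G (G.color u) t := by
  rw [mem_hi]
  intro w hw hc
  by_contra hwt
  have h1 := hm w hwt
  have h2 := chain_le G hG hw
  exact hc (hG.2.1 _ _ (by omega))

lemma ind_le (hG : G.IsTwoColorGridPoset) {t : Finset P} (ht : IsIdeal t) {u : P} (hu : u ∉ t)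
    (hm : ∀ v, v ∉ t → G.chain v ≤ G.chain u) (i : ℕ) :
    ind (G.chain u) i ≤ ((Fc G (G.color u) t i).filter (· ∉ t)).card := by
  unfold ind
  split_ifs with h
  · rw [Nat.one_le_iff_ne_zero, Finset.card_ne_zero]
    refine ⟨u, Finset.mem_filter.mpr ⟨mem_Fc.mpr ⟨chain_hi hG hm rfl, ?_, h.symm⟩, hu⟩⟩
    exact fun h' => hu (lo_sub G ht h')
  · exact Nat.zero_le _

lemma exists_isMax_ge (x : P) : ∃ z, x ≤ z ∧ IsMax z := by
  obtain ⟨z, h1, h2⟩ := (Set.toFinite (Set.univ : Set P)).exists_le_maximal (Set.mem_univ x)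
  exact ⟨z, h1, fun y hy => h2.2 (Set.mem_univ _) hy⟩

lemma lo_high (hG : G.IsTwoColorGridPoset) (hmax : G.MaxProperty) {t : Finset P} {u : P}
    (hm : ∀ v, v ∉ t → G.chain v ≤ G.chain u) {x : P} (hx : G.chain u < G.chain x) :
    x ∈ lo G (G.color u) t := by
  have hxt : x ∈ t := by
    by_contra h
    have := hm x h
    omega
  by_cases hc : G.color x = G.color u
  · obtain ⟨z, hxz, hz⟩ := exists_isMax_ge x
    have h1 := chain_le G hG hxz
    rcases h1.lt_or_eq with h2 | h2
    · obtain ⟨w, h3, h4, h5, h6⟩ := chain_step G hG hxz h2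
      rw [hc] at h6
      refine (mem_lo G).mpr ⟨w, ?_, h6, h3⟩
      by_contra hw
      have h7 := hm w hw
      exact h6 (hG.2.1 _ _ (by omega))
    · exfalso
      have hz2 := hmax.1 z hz
      obtain ⟨y, huy, hy⟩ := exists_isMax_ge u
      have h3 := chain_le G hG huy
      have h4 := (Finset.mem_Icc.mp (hG.1.2.1 y)).1
      refine hmax.2 y z hy hz ?_ ?_
      · rintro rfl; omega
      · rw [hG.2.1 y u (by omega), hG.2.1 z x h2, hc]
  · exact (mem_lo G).mpr ⟨x, hxt, hc, le_rfl⟩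

/-- The sign reversing involution. -/
noncomputable def flip (G : GridData P) (t : Finset P) : Finset P :=
  if h : ∃ u, u ∉ t ∧ ∀ v, v ∉ t → G.chain v ≤ G.chain u then
    rfn G (G.color h.choose) (ind (G.chain h.choose)) t else t

lemma flip_eq (hG : G.IsTwoColorGridPoset) {t : Finset P} {u : P} (hu : u ∉ t)
    (hm : ∀ v, v ∉ t → G.chain v ≤ G.chain u) :
    flip G t = rfn G (G.color u) (ind (G.chain u)) t := by
  have h : ∃ u, u ∉ t ∧ ∀ v, v ∉ t → G.chain v ≤ G.chain u := ⟨u, hu, hm⟩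
  have h1 : G.chain h.choose = G.chain u :=
    le_antisymm (hm _ h.choose_spec.1) (h.choose_spec.2 _ hu)
  rw [flip, dif_pos h, hG.2.1 _ _ h1, h1]

lemma exists_top {t : Finset P} (ht : t ≠ Finset.univ) :
    ∃ u, u ∉ t ∧ ∀ v, v ∉ t → G.chain v ≤ G.chain u := by
  have : (tᶜ).Nonempty := by
    rw [Finset.nonempty_iff_ne_empty]
    intro h
    exact ht (by simpa using h)
  obtain ⟨u, h1, h2⟩ := Finset.exists_max_image tᶜ G.chain this
  exact ⟨u, Finset.mem_compl.mp h1, fun v hv => h2 v (Finset.mem_compl.mpr hv)⟩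

lemma flip_top (hG : G.IsTwoColorGridPoset) (hmax : G.MaxProperty) {t : Finset P} (ht : IsIdeal t)
    {u : P} (hu : u ∉ t) (hm : ∀ v, v ∉ t → G.chain v ≤ G.chain u) :
    ∃ x, x ∉ flip G t ∧ G.chain x = G.chain u ∧ ∀ v, v ∉ flip G t → G.chain v ≤ G.chain x := by
  rw [flip_eq hG hu hm]
  have h1 := card_out hG (G.chain u) (ind_le hG ht hu hm (G.chain u))
  have h2 : ((Fc G (G.color u) t (G.chain u)).filter
      (· ∉ rfn G (G.color u) (ind (G.chain u)) t)).Nonempty := by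
    rw [← Finset.card_pos, h1]
    simp [ind]
  obtain ⟨x, hx⟩ := h2
  rw [Finset.mem_filter] at hx
  refine ⟨x, hx.2, (mem_Fc.mp hx.1).2.2, ?_⟩
  intro v hv
  rw [(mem_Fc.mp hx.1).2.2]
  by_contra h
  exact hv (lo_rfn ht (lo_high hG hmax hm (not_le.mp h)))

lemma sum_ind (u : P) : ∑ i ∈ Finset.univ.image G.chain, (ind (G.chain u) i : ℤ) = 1 := by
  unfold ind
  push_cast
  rw [Finset.sum_ite_eq']
  simp

lemma sum_cancel (hG : G.IsTwoColorGridPoset) (hmax : G.MaxProperty) (hM : G.MStructured M)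
    {R : Type*} [AddCommGroup R] (hR : ∀ x : R, x = - x → x = 0) (f : (Fin 2 → ℤ) → R)
    (hf : ∀ γ μ, f (μ - (μ γ + 1) • M γ) = - f μ) :
    ∑ t ∈ Ids P, f (G.wt t) = f (G.wt Finset.univ) := by
  rw [← Finset.add_sum_erase _ _ (mem_Ids.mpr univ_ideal)]
  have key : ∀ t ∈ (Ids P).erase Finset.univ, f (G.wt (flip G t)) = - f (G.wt t) := by
    intro t ht
    obtain ⟨h1, h2⟩ := Finset.mem_erase.mp ht
    rw [mem_Ids] at h2
    obtain ⟨u, hu, hm⟩ := exists_top (G := G) h1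
    rw [flip_eq hG hu hm, wt_rfn hG hM h2 (ind_le hG h2 hu hm), sum_ind, hf]
  rw [Finset.sum_involution (fun t _ => flip G t), add_zero]
  · intro t ht
    rw [key t ht]; abel
  · intro t ht h0 h1
    have := key t ht
    rw [h1] at this
    exact h0 (hR _ this)
  · intro t ht
    obtain ⟨h1, h2⟩ := Finset.mem_erase.mp ht
    rw [mem_Ids] at h2
    obtain ⟨u, hu, hm⟩ := exists_top (G := G) h1
    obtain ⟨x, hx, _⟩ := flip_top hG hmax h2 hu hm
    refine Finset.mem_erase.mpr ⟨fun h => hx (h ▸ Finset.mem_univ _), mem_Ids.mpr ?_⟩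
    rw [flip_eq hG hu hm]
    exact rfn_ideal hG _ _ _
  · intro t ht
    obtain ⟨h1, h2⟩ := Finset.mem_erase.mp ht
    rw [mem_Ids] at h2
    obtain ⟨u, hu, hm⟩ := exists_top (G := G) h1
    obtain ⟨x, hx, hxu, hxm⟩ := flip_top hG hmax h2 hu hm
    rw [flip_eq hG hx hxm, hG.2.1 _ _ hxu, hxu, flip_eq hG hu hm]
    exact rfn_rfn hG h2 (ind_le hG h2 hu hm)

end G2Uni

namespace G2Uni
open LaurentPolynomial
variable {P : Type} [PartialOrder P] [Fintype P] {G : GridData P}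

/-- The specialized alternating sum over the Weyl group. -/
noncomputable def Alt (A B : ℤ) : LaurentPolynomial ℤ :=
  T (3 * A + 5 * B) + T (-3 * A + -5 * B) - T (2 * A + 5 * B) - T (-2 * A + -5 * B)
    - T (3 * A + 4 * B) - T (-3 * A + -4 * B) + T (2 * A + 1 * B) + T (-2 * A + -1 * B)
    + T (1 * A + 4 * B) + T (-1 * A + -4 * B) - T (1 * A + -1 * B) - T (-1 * A + 1 * B)

lemma Alt_s1 (A B : ℤ) : Alt (-A) (A + B) = - Alt A B := by
  unfold Alt
  ring_nf

lemma Alt_s2 (A B : ℤ) : Alt (A + 3 * B) (-B) = - Alt A B := by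
  unfold Alt
  ring_nf

/-- Specialized character. -/
noncomputable def Sp (G : GridData P) (x y : ℤ) : LaurentPolynomial ℤ :=
  ∑ t ∈ Ids P, T (x * G.wt t 0 + y * G.wt t 1)

lemma Sp_s1a (hG : G.IsTwoColorGridPoset) (hM : G.MStructured !![2, -1; -3, 2]) (x y : ℤ) :
    Sp G x y = Sp G (y - x) y := by
  unfold Sp
  rw [sum_refl hG hM 0 (fun μ => T (x * μ 0 + y * μ 1))]
  refine Finset.sum_congr rfl fun t _ => ?_
  congr 1
  simp
  ring

lemma Sp_s2a (hG : G.IsTwoColorGridPoset) (hM : G.MStructured !![2, -1; -3, 2]) (x y : ℤ) :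
    Sp G x y = Sp G x (3 * x - y) := by
  unfold Sp
  rw [sum_refl hG hM 1 (fun μ => T (x * μ 0 + y * μ 1))]
  refine Finset.sum_congr rfl fun t _ => ?_
  congr 1
  simp
  ring

lemma Sp_s1 (hG : G.IsTwoColorGridPoset) (hM : G.MStructured !![2, -1; -3, 2]) {x y : ℤ} (z : ℤ)
    (h : z = y - x) : Sp G z y = Sp G x y := by
  rw [h, ← Sp_s1a hG hM]

lemma Sp_s2 (hG : G.IsTwoColorGridPoset) (hM : G.MStructured !![2, -1; -3, 2]) {x y : ℤ} (z : ℤ)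
    (h : z = 3 * x - y) : Sp G x z = Sp G x y := by
  rw [h, ← Sp_s2a hG hM]

lemma sum_Alt (hG : G.IsTwoColorGridPoset) (hM : G.MStructured !![2, -1; -3, 2]) :
    ∑ t ∈ Ids P, Alt (G.wt t 0 + 1) (G.wt t 1 + 1) = Alt 1 1 * Sp G 3 5 := by
  have e1 : Sp G 2 5 = Sp G 3 5 := (Sp_s1 hG hM 2 (by norm_num))
  have e2 : Sp G 3 4 = Sp G 3 5 := (Sp_s2 hG hM 4 (by norm_num))
  have e3 : Sp G 2 1 = Sp G 3 5 := (Sp_s2 hG hM 1 (by norm_num)).trans e1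
  have e4 : Sp G 1 4 = Sp G 3 5 := (Sp_s1 hG hM 1 (by norm_num)).trans e2
  have e5 : Sp G (-1) 1 = Sp G 3 5 := (Sp_s1 hG hM (-1) (by norm_num)).trans e3
  have e6 : Sp G 1 (-1) = Sp G 3 5 := (Sp_s2 hG hM (-1) (by norm_num)).trans e4
  have e7 : Sp G (-1) (-4) = Sp G 3 5 := (Sp_s2 hG hM (-4) (by norm_num)).trans e5
  have e8 : Sp G (-2) (-1) = Sp G 3 5 := (Sp_s1 hG hM (-2) (by norm_num)).trans e6
  have e9 : Sp G (-3) (-4) = Sp G 3 5 := (Sp_s1 hG hM (-3) (by norm_num)).trans e7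
  have e10 : Sp G (-2) (-5) = Sp G 3 5 := (Sp_s2 hG hM (-5) (by norm_num)).trans e8
  have e11 : Sp G (-3) (-5) = Sp G 3 5 := (Sp_s2 hG hM (-5) (by norm_num)).trans e9
  have key : ∀ x y : ℤ, ∑ t ∈ Ids P, (T (x * (G.wt t 0 + 1) + y * (G.wt t 1 + 1)) : LaurentPolynomial ℤ)
      = T (x * 1 + y * 1) * Sp G x y := by
    intro x y
    rw [Sp, Finset.mul_sum]
    refine Finset.sum_congr rfl fun t _ => ?_
    rw [← T_add]
    congr 1; ring
  simp only [Alt, Finset.sum_add_distrib, Finset.sum_sub_distrib, key]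
  rw [e1, e2, e3, e4, e5, e6, e7, e8, e9, e10, e11]
  ring

lemma lp_neg (x : LaurentPolynomial ℤ) (h : x = - x) : x = 0 := by
  ext n
  have h3 := congrArg (fun z : LaurentPolynomial ℤ => z.coeff n) h
  simp at h3 ⊢
  omega

lemma weyl (hG : G.IsTwoColorGridPoset) (hmax : G.MaxProperty)
    (hM : G.MStructured !![2, -1; -3, 2]) :
    Alt 1 1 * Sp G 3 5 = Alt (G.wt Finset.univ 0 + 1) (G.wt Finset.univ 1 + 1) := by
  rw [← sum_Alt hG hM]
  refine sum_cancel hG hmax hM lp_neg (fun μ => Alt (μ 0 + 1) (μ 1 + 1)) ?_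
  intro γ μ
  fin_cases γ
  · rw [← Alt_s1]
    congr 1 <;> simp <;> ring
  · rw [← Alt_s2]
    congr 1 <;> simp <;> ring

/-- The factorization of the alternating sum. -/
lemma Alt_prod (A B : ℕ) : T (3 * A + 5 * B) * Alt A B = Polynomial.toLaurent
    (((1 : Polynomial ℤ) - Polynomial.X ^ A) * (1 - Polynomial.X ^ B) * (1 - Polynomial.X ^ (A + B))
      * (1 - Polynomial.X ^ (A + 2 * B)) * (1 - Polynomial.X ^ (A + 3 * B))
      * (1 - Polynomial.X ^ (2 * A + 3 * B))) := by
  have key : ∀ (x y : ℕ) (i j : ℤ), 3 + i = x → 5 + j = y → T (3 * A + 5 * B) * T (i * A + j * B)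
      = (T A ^ x * T B ^ y : LaurentPolynomial ℤ) := by
    intro x y i j hx hy
    rw [T_pow, T_pow, ← T_add, ← T_add, ← hx, ← hy]
    congr 1; ring
  have hX : ∀ n : ℕ, Polynomial.toLaurent ((Polynomial.X : Polynomial ℤ) ^ n) = T n := by
    intro n; rw [Polynomial.toLaurent_X_pow]
  simp only [map_mul, map_sub, map_one, pow_add, pow_mul']
  simp only [map_mul, map_pow, hX]
  unfold Alt
  simp only [mul_add, mul_sub]
  rw [key 6 10 _ _ rfl rfl, key 0 0 _ _ rfl rfl, key 5 10 _ _ rfl rfl, key 1 0 _ _ rfl rfl,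
    key 6 9 _ _ rfl rfl, key 0 1 _ _ rfl rfl, key 5 6 _ _ rfl rfl, key 1 4 _ _ rfl rfl,
    key 4 9 _ _ rfl rfl, key 2 1 _ _ rfl rfl, key 4 4 _ _ rfl rfl, key 2 6 _ _ rfl rfl]
  ring

end G2Uni

namespace G2Uni
variable {P : Type} [PartialOrder P] [Fintype P] {G : GridData P}

/-- Simple reflections. -/
def sg (γ : Fin 2) (μ : Fin 2 → ℤ) : Fin 2 → ℤ := μ - μ γ • (!![2, -1; -3, 2] : Matrix (Fin 2) (Fin 2) ℤ) γ

lemma sg_six (μ : Fin 2 → ℤ) : sg 0 (sg 1 (sg 0 (sg 1 (sg 0 (sg 1 μ))))) = - μ := by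
  ext i
  fin_cases i <;> simp [sg] <;> ring

lemma exists_neg (hG : G.IsTwoColorGridPoset) (hM : G.MStructured !![2, -1; -3, 2]) {t : Finset P}
    (ht : IsIdeal t) : ∃ s, IsIdeal s ∧ G.wt s = - G.wt t := by
  have key : ∀ γ, ∀ s, IsIdeal s → ∃ s', IsIdeal s' ∧ G.wt s' = sg γ (G.wt s) :=
    fun γ s hs => exists_refl hG hM γ hs
  obtain ⟨s1, h1, e1⟩ := key 1 t ht
  obtain ⟨s2, h2, e2⟩ := key 0 s1 h1
  obtain ⟨s3, h3, e3⟩ := key 1 s2 h2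
  obtain ⟨s4, h4, e4⟩ := key 0 s3 h3
  obtain ⟨s5, h5, e5⟩ := key 1 s4 h4
  obtain ⟨s6, h6, e6⟩ := key 0 s5 h5
  exact ⟨s6, h6, by rw [e6, e5, e4, e3, e2, e1, sg_six]⟩

lemma sum_neg_wt (hG : G.IsTwoColorGridPoset) (hM : G.MStructured !![2, -1; -3, 2])
    (g : (Fin 2 → ℤ) → ℤ) : ∑ t ∈ Ids P, g (G.wt t) = ∑ t ∈ Ids P, g (- G.wt t) := by
  have key : ∀ γ, ∀ g : (Fin 2 → ℤ) → ℤ, ∑ t ∈ Ids P, g (G.wt t) = ∑ t ∈ Ids P, g (sg γ (G.wt t)) :=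
    fun γ g => sum_refl hG hM γ g
  rw [key 0 g, key 1 (fun μ => g (sg 0 μ)), key 0 (fun μ => g (sg 0 (sg 1 μ))),
    key 1 (fun μ => g (sg 0 (sg 1 (sg 0 μ)))), key 0 (fun μ => g (sg 0 (sg 1 (sg 0 (sg 1 μ))))),
    key 1 (fun μ => g (sg 0 (sg 1 (sg 0 (sg 1 (sg 0 μ))))))]
  simp only [sg_six]

lemma height (hM : G.MStructured !![2, -1; -3, 2]) {t : Finset P} (ht : IsIdeal t) :
    3 * G.wt Finset.univ 0 + 5 * G.wt Finset.univ 1 =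
      3 * G.wt t 0 + 5 * G.wt t 1 + (Fintype.card P - t.card) := by
  rw [← Finset.card_univ]
  refine climb t Finset.univ ht univ_ideal (Finset.subset_univ _)
    (fun x => 3 * G.wt x 0 + 5 * G.wt x 1 = 3 * G.wt t 0 + 5 * G.wt t 1 + ((x.card : ℤ) - t.card))
    (by ring) ?_
  intro x u hx hux _ _ hu h1
  rw [← hM x _ hx hux u hu rfl, Finset.card_insert_of_notMem hu]
  push_cast
  have : ∀ c : Fin 2, 3 * (!![2, -1; -3, 2] : Matrix (Fin 2) (Fin 2) ℤ) c 0
      + 5 * (!![2, -1; -3, 2] : Matrix (Fin 2) (Fin 2) ℤ) c 1 = 1 := by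
    intro c; fin_cases c <;> simp
  have := this (G.color u)
  simp only [Pi.add_apply]
  linarith

lemma card_P (hG : G.IsTwoColorGridPoset) (hM : G.MStructured !![2, -1; -3, 2]) :
    (Fintype.card P : ℤ) = 2 * (3 * G.wt Finset.univ 0 + 5 * G.wt Finset.univ 1) := by
  obtain ⟨s, hs, e⟩ := exists_neg hG hM (univ_ideal (P := P))
  obtain ⟨r, hr, e'⟩ := exists_neg hG hM (empty_ideal (P := P))
  have h1 := height hM hs
  have h2 := height hM hr
  have h3 := height hM (empty_ideal (P := P))
  rw [e] at h1
  rw [e'] at h2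
  simp only [Pi.neg_apply, Finset.card_empty] at h1 h2 h3
  have h4 := Finset.card_le_univ r
  zify at h4
  push_cast at h3
  have h5 : (0 : ℤ) ≤ s.card := by positivity
  linarith

lemma card_t (hG : G.IsTwoColorGridPoset) (hM : G.MStructured !![2, -1; -3, 2]) {t : Finset P}
    (ht : IsIdeal t) : (t.card : ℤ) = (3 * G.wt t 0 + 5 * G.wt t 1)
      + (3 * G.wt Finset.univ 0 + 5 * G.wt Finset.univ 1) := by
  have h1 := height hM ht
  have h2 := card_P hG hM
  linarith

lemma RGF_eq : RGF P = ∑ t ∈ Ids P, Polynomial.X ^ t.card := rfl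

lemma RGF_coeff (k : ℕ) : (RGF P).coeff k = ∑ t ∈ Ids P, if k = t.card then 1 else 0 := by
  rw [RGF_eq, Polynomial.finsetSum_coeff]
  simp only [Polynomial.coeff_X_pow]

lemma RGF_symm (hG : G.IsTwoColorGridPoset) (hM : G.MStructured !![2, -1; -3, 2]) (h : ℕ)
    (hh : (h : ℤ) = 3 * G.wt Finset.univ 0 + 5 * G.wt Finset.univ 1) (k : ℕ) (hk : k ≤ 2 * h) :
    (RGF P).coeff k = (RGF P).coeff (2 * h - k) := by
  rw [RGF_coeff, RGF_coeff]
  have e1 : ∀ k : ℕ, (∑ t ∈ Ids P, if k = t.card then (1 : ℤ) else 0) =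
      ∑ t ∈ Ids P, if (k : ℤ) = (3 * G.wt t 0 + 5 * G.wt t 1) + h then 1 else 0 := by
    intro k
    refine Finset.sum_congr rfl fun t ht => ?_
    rw [hh, ← card_t hG hM (mem_Ids.mp ht)]
    simp
  rw [e1, e1, sum_neg_wt hG hM (fun μ => if (k : ℤ) = (3 * μ 0 + 5 * μ 1) + h then 1 else 0)]
  refine Finset.sum_congr rfl fun t ht => ?_
  congr 1
  simp only [Pi.neg_apply, eq_iff_iff]
  omega

lemma RGF_natDegree (hG : G.IsTwoColorGridPoset) (hM : G.MStructured !![2, -1; -3, 2]) (h : ℕ)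
    (hh : (h : ℤ) = 3 * G.wt Finset.univ 0 + 5 * G.wt Finset.univ 1) :
    (RGF P).natDegree = 2 * h := by
  have hc : Fintype.card P = 2 * h := by
    have := card_P hG hM
    omega
  apply Polynomial.natDegree_eq_of_le_of_coeff_ne_zero
  · rw [RGF_eq]
    refine Polynomial.natDegree_sum_le_of_forall_le _ _ fun t _ => ?_
    rw [Polynomial.natDegree_X_pow, ← hc]
    exact Finset.card_le_univ t
  · rw [RGF_coeff]
    have : 0 < ∑ t ∈ Ids P, if 2 * h = t.card then (1 : ℤ) else 0 := by
      refine Finset.sum_pos' (fun t _ => by split_ifs <;> norm_num) ⟨Finset.univ, mem_Ids.mpr univ_ideal, ?_⟩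
      rw [Finset.card_univ, hc]; simp
    omega

lemma RGF_formula (hG : G.IsTwoColorGridPoset) (hmax : G.MaxProperty)
    (hM : G.MStructured !![2, -1; -3, 2]) (a b : ℕ) (ha : (a : ℤ) = G.wt Finset.univ 0)
    (hb : (b : ℤ) = G.wt Finset.univ 1) :
    RGF P * (((1 : Polynomial ℤ) - Polynomial.X ^ 1) * (1 - Polynomial.X ^ 1)
      * (1 - Polynomial.X ^ (1 + 1)) * (1 - Polynomial.X ^ (1 + 2 * 1)) * (1 - Polynomial.X ^ (1 + 3 * 1))
      * (1 - Polynomial.X ^ (2 * 1 + 3 * 1))) =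
    (((1 : Polynomial ℤ) - Polynomial.X ^ (a + 1)) * (1 - Polynomial.X ^ (b + 1))
      * (1 - Polynomial.X ^ ((a + 1) + (b + 1)))
      * (1 - Polynomial.X ^ ((a + 1) + 2 * (b + 1))) * (1 - Polynomial.X ^ ((a + 1) + 3 * (b + 1)))
      * (1 - Polynomial.X ^ (2 * (a + 1) + 3 * (b + 1)))) := by
  apply Polynomial.toLaurent_injective
  rw [map_mul, ← Alt_prod, ← Alt_prod]
  have e1 : Polynomial.toLaurent (RGF P) = LaurentPolynomial.T (3 * a + 5 * b) * Sp G 3 5 := by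
    rw [RGF_eq, map_sum, Sp, Finset.mul_sum]
    refine Finset.sum_congr rfl fun t ht => ?_
    rw [Polynomial.toLaurent_X_pow, ← LaurentPolynomial.T_add, card_t hG hM (mem_Ids.mp ht), ha, hb]
    congr 1; ring
  have e2 := weyl hG hmax hM
  rw [← ha, ← hb] at e2
  push_cast
  rw [← e2, e1]
  rw [show (3 * ((a : ℤ) + 1) + 5 * ((b : ℤ) + 1)) = (3 * a + 5 * b) + (3 * 1 + 5 * 1) by ring,
    LaurentPolynomial.T_add (3 * (a : ℤ) + 5 * b)]
  ring

lemma kap_zero {T : Type*} [AddCommGroup T] [Module ℚ T] (S : HW T) (k : ℕ) (hk : S.N ≤ k) :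
    S.kap k = 0 := by
  unfold HW.kap
  apply Finset.sum_eq_zero
  intro i hi
  apply S.M_big
  unfold HW.N at hk
  omega

open Polynomial in
lemma RGF_mono (hG : G.IsTwoColorGridPoset) (hmax : G.MaxProperty)
    (hM : G.MStructured !![2, -1; -3, 2]) (a b : ℕ) (ha : (a : ℤ) = G.wt Finset.univ 0)
    (hb : (b : ℤ) = G.wt Finset.univ 1) (k : ℕ) (hk : k < 3 * a + 5 * b) :
    (RGF P).coeff k ≤ (RGF P).coeff (k + 1) := by
  have h1 := congrArg (Polynomial.map (Int.castRingHom ℚ)) (RGF_formula hG hmax hM a b ha hb)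
  have h2 := (hw a b).kap_formula
  have ea : (hw a b).a = a := rfl
  have eb : (hw a b).b = b := rfl
  rw [ea, eb] at h2
  simp only [Polynomial.map_mul, Polynomial.map_sub, Polynomial.map_pow, Polynomial.map_one,
    Polynomial.map_X] at h1
  have h3 : (RGF P).map (Int.castRingHom ℚ) =
      ∑ k ∈ Finset.range (hw a b).N, C ((hw a b).kap k : ℚ) * X ^ k := by
    have hne : ((1 - X) * (1 - X) * (1 - X ^ 2) * (1 - X ^ 3) * (1 - X ^ 4) * (1 - X ^ 5) : ℚ[X]) ≠ 0 := by
      intro h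
      have := congrArg (Polynomial.eval 2) h
      norm_num at this
    apply mul_right_cancel₀ hne
    rw [h2]
    convert h1 using 2 <;> ring_nf
  have h4 : ∀ n, ((RGF P).coeff n : ℚ) = (hw a b).kap n := by
    intro n
    have := congrArg (fun p => Polynomial.coeff p n) h3
    simp only [Polynomial.coeff_map, Polynomial.finsetSum_coeff, Polynomial.coeff_C_mul_X_pow] at this
    rw [Finset.sum_ite_eq] at this
    simp only [Finset.mem_range, eq_intCast] at this
    rw [this]
    split_ifs with h
    · rfl
    · rw [kap_zero _ _ (not_lt.mp h)]; simp
  have h5 := (hw a b).kap_mono k hk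
  have h6 : ((RGF P).coeff k : ℚ) ≤ (RGF P).coeff (k + 1) := by
    rw [h4, h4]; exact_mod_cast h5
  exact_mod_cast h6

end G2Uni

open Polynomial in
theorem stmt_7 {P : Type} [PartialOrder P] [Fintype P] (G : GridData P)
    (hG : G.IsTwoColorGridPoset) (hmax : G.MaxProperty)
    (hM : G.MStructured !![2, -1; -3, 2])
    (a b : ℤ) (ha : a = G.wt Finset.univ 0) (hb : b = G.wt Finset.univ 1) :
    0 ≤ a ∧ 0 ≤ b ∧ PolySymmetric (RGF P) ∧ PolyUnimodal (RGF P) ∧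
      RGF P * ((1 : ℤ[X]) - X) * (1 - X) * (1 - X ^ 2) * (1 - X ^ 3) * (1 - X ^ 4) * (1 - X ^ 5) = ((1 : ℤ[X]) - X ^ (a + 1).toNat) * (1 - X ^ (b + 1).toNat) * (1 - X ^ (a + b + 2).toNat) * (1 - X ^ (a + 2 * b + 3).toNat) * (1 - X ^ (a + 3 * b + 4).toNat) * (1 - X ^ (2 * a + 3 * b + 5).toNat) := by
  have ha0 : 0 ≤ a := by rw [ha]; exact G2Uni.wt_univ_nonneg 0
  have hb0 : 0 ≤ b := by rw [hb]; exact G2Uni.wt_univ_nonneg 1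
  refine ⟨ha0, hb0, ?_⟩
  lift a to ℕ using ha0
  lift b to ℕ using hb0
  have hh : ((3 * a + 5 * b : ℕ) : ℤ) = 3 * G.wt Finset.univ 0 + 5 * G.wt Finset.univ 1 := by
    rw [← ha, ← hb]; push_cast; ring
  have hd := G2Uni.RGF_natDegree hG hM _ hh
  have hs := G2Uni.RGF_symm hG hM _ hh
  have hm : ∀ i j, i ≤ j → j ≤ 3 * a + 5 * b → (RGF P).coeff i ≤ (RGF P).coeff j := by
    intro i j hij
    induction j, hij using Nat.le_induction with
    | base => intro _; exact le_rfl
    | succ n hn ih =>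
      intro h
      exact (ih (by omega)).trans (G2Uni.RGF_mono hG hmax hM a b ha hb n (by omega))
  refine ⟨?_, ⟨3 * a + 5 * b, hm, ?_⟩, ?_⟩
  · intro i hi
    rw [hd] at hi ⊢
    exact hs i hi
  · intro i j hi hij hj
    rw [hd] at hj
    rw [hs i (by omega), hs j hj]
    exact hm _ _ (by omega) (by omega)
  · have h := G2Uni.RGF_formula hG hmax hM a b ha hb
    rw [show ((a : ℤ) + 1).toNat = a + 1 by omega, show ((b : ℤ) + 1).toNat = b + 1 by omega,
      show ((a : ℤ) + b + 2).toNat = (a + 1) + (b + 1) by omega,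
      show ((a : ℤ) + 2 * b + 3).toNat = (a + 1) + 2 * (b + 1) by omega,
      show ((a : ℤ) + 3 * b + 4).toNat = (a + 1) + 3 * (b + 1) by omega,
      show (2 * (a : ℤ) + 3 * b + 5).toNat = 2 * (a + 1) + 3 * (b + 1) by omega, ← h]
    norm_num
    ring
end

section
/- Let P be a two-color grid poset, L := J_color(P), t ∈ L with t ≠ max, and γ := κ(t). Then F := {s ∈ comp_γ(t) : v(t) ∈ s} is a face of comp_γ(t) with respect to the poset isomorphism φ. -/
open scoped Classical

namespace GridData

variable {P : Type} [PartialOrder P] [Fintype P]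

/-- The indices `i ∈ {1,…,m}` of the fibers whose vertices have color `γ`. -/
def colorIdx (G : GridData P) (γ : Fin 2) : Finset ℕ :=
  (Finset.Icc 1 G.m).filter (fun i => ∃ u : P, G.chain u = i ∧ G.color u = γ)

/-- `I_j`: the largest subset `I` of the fiber `C i` such that both `t ∪ I` and
`t \ I` are order ideals (realized as the union of all such subsets). -/
noncomputable def Imax (G : GridData P) (t : Finset P) (i : ℕ) : Finset P :=
  (G.fiber i).filter (fun x =>
    ∃ J ⊆ G.fiber i, x ∈ J ∧ IsIdeal (t ∪ J) ∧ IsIdeal (t \ J))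

/-- The largest index `k ∈ {1,…,m}` such that the fiber `C k` is not contained in `t`. -/
noncomputable def kIdx (G : GridData P) (t : Finset P) : ℕ :=
  sSup {i | i ∈ Finset.Icc 1 G.m ∧ ¬ G.fiber i ⊆ t}

/-- `z_i`, the maximal element of the (chain) fiber `C i`. -/
noncomputable def zEl [Nonempty P] (G : GridData P) (i : ℕ) : P :=
  if h : ∃ z ∈ G.fiber i, ∀ w ∈ G.fiber i, w ≤ z then h.choose else Classical.arbitrary P

/-- `v(t) := z_k` where `k` is the largest index with `C_k ⊄ t`. -/
noncomputable def vOf [Nonempty P] (G : GridData P) (t : Finset P) : P :=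
  G.zEl (G.kIdx t)

/-- The vertex-coloring function `κ(t) := color(v(t))`. -/
noncomputable def kOf [Nonempty P] (G : GridData P) (t : Finset P) : Fin 2 :=
  G.color (G.vOf t)

/-- A face of `comp_γ(t)` with respect to the isomorphism
`φ(s) = (s ∩ I_1, …, s ∩ I_k)`: for some color-`γ` fiber index `q`, the set of
elements of `comp_γ(t)` whose `q`-th coordinate `s ∩ I_q` is the maximal element
`I_q` of the chain `J(I_q)`. -/
def IsFace (G : GridData P) (γ : Fin 2) (t : Finset P) (S : Set (Finset P)) : Prop :=
  ∃ q ∈ G.colorIdx γ, S = {s | s ∈ G.comp γ t ∧ G.Imax t q ⊆ s}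

/-- A sub-face of `comp_γ(t)`: the complement (within `comp_γ(t)`) of a face. -/
def IsSubFace (G : GridData P) (γ : Fin 2) (t : Finset P) (S : Set (Finset P)) : Prop :=
  ∃ q ∈ G.colorIdx γ, S = {s | s ∈ G.comp γ t ∧ ¬ G.Imax t q ⊆ s}

end GridData

theorem chain_anti_aux {P : Type} [PartialOrder P] [Fintype P] (G : GridData P)
    (hG : G.IsGridPoset) {u w : P} (h : u ≤ w) : G.chain w ≤ G.chain u := by
  letI : LocallyFiniteOrder P := Fintype.toLocallyFiniteOrder
  have h' := le_iff_reflTransGen_covBy.1 h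
  induction h' with
  | refl => exact le_rfl
  | tail hab hbc ih =>
    have h1 := ih (le_iff_reflTransGen_covBy.2 hab)
    have h2 := hG.2.2.2.2 _ _ hbc
    omega

theorem comp_ideal_aux {P : Type} [PartialOrder P] [Fintype P] (G : GridData P)
    (γ : Fin 2) {t s : Finset P} (ht : IsIdeal t) (hs : s ∈ G.comp γ t) : IsIdeal s := by
  have hs' : Relation.ReflTransGen (G.GStep γ) t s := hs
  cases hs' with
  | refl => exact ht
  | tail _ h => exact h.2.1

theorem zEl_spec_aux {P : Type} [PartialOrder P] [Fintype P] [Nonempty P] (G : GridData P)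
    (hG : G.IsGridPoset) (i : ℕ) (hi : (G.fiber i).Nonempty) :
    G.zEl i ∈ G.fiber i ∧ ∀ w ∈ G.fiber i, w ≤ G.zEl i := by
  have h : ∃ z ∈ G.fiber i, ∀ w ∈ G.fiber i, w ≤ z := by
    obtain ⟨z, hz⟩ := (G.fiber i).exists_maximal hi
    refine ⟨z, hz.1, fun w hw => ?_⟩
    have hzc : G.chain z = i := by simpa [GridData.fiber] using hz.1
    have hwc : G.chain w = i := by simpa [GridData.fiber] using hw
    rcases hG.2.2.2.1 w z (hwc.trans hzc.symm) with h | h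
    · exact h
    · exact hz.2 hw h
  unfold GridData.zEl
  rw [dif_pos h]
  exact h.choose_spec

/-- `F := {s ∈ comp_γ(t) : v(t) ∈ s}` is a face of `comp_γ(t)`, where `γ = κ(t)`. -/
theorem stmt_15 {P : Type} [PartialOrder P] [Fintype P] [Nonempty P] (G : GridData P)
    (hG : G.IsTwoColorGridPoset)
    (t : Finset P) (ht : IsIdeal t) (htop : t ≠ Finset.univ)
    (γ : Fin 2) (hγ : γ = G.kOf t) :
    G.IsFace γ t {s | s ∈ G.comp γ t ∧ G.vOf t ∈ s} := by
  classical
  obtain ⟨hP, -, -⟩ := hG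
  have hbdd : BddAbove {i | i ∈ Finset.Icc 1 G.m ∧ ¬ G.fiber i ⊆ t} :=
    ⟨G.m, fun i hi => (Finset.mem_Icc.1 hi.1).2⟩
  have hout : ∀ x, x ∉ t → G.chain x ≤ G.kIdx t := by
    intro x hx
    refine le_csSup hbdd ⟨hP.2.1 x, fun hs => hx (hs ?_)⟩
    simp [GridData.fiber]
  have hne : {i | i ∈ Finset.Icc 1 G.m ∧ ¬ G.fiber i ⊆ t}.Nonempty := by
    have : ∃ x, x ∉ t := by
      by_contra hc
      push Not at hc
      exact htop (Finset.eq_univ_iff_forall.2 hc)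
    obtain ⟨x, hx⟩ := this
    refine ⟨G.chain x, hP.2.1 x, fun hs => hx (hs ?_)⟩
    simp [GridData.fiber]
  have hk : G.kIdx t ∈ Finset.Icc 1 G.m ∧ ¬ G.fiber (G.kIdx t) ⊆ t := Nat.sSup_mem hne hbdd
  obtain ⟨x, hxf, hxt⟩ := Finset.not_subset.1 hk.2
  have hz := zEl_spec_aux G hP (G.kIdx t) ⟨x, hxf⟩
  change G.vOf t ∈ _ ∧ ∀ w ∈ _, w ≤ G.vOf t at hz
  have hvt : G.vOf t ∉ t := fun h => hxt (ht h (hz.2 x hxf))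
  have hvc : G.chain (G.vOf t) = G.kIdx t := by simpa [GridData.fiber] using hz.1
  refine ⟨G.kIdx t, ?_, ?_⟩
  · exact Finset.mem_filter.2 ⟨hk.1, G.vOf t, hvc, hγ.symm⟩
  · ext s
    constructor
    · rintro ⟨hs, hv⟩
      refine ⟨hs, fun w hw => ?_⟩
      exact comp_ideal_aux G γ ht hs hv (hz.2 w (Finset.mem_filter.1 hw).1)
    · rintro ⟨hs, hI⟩
      refine ⟨hs, hI (Finset.mem_filter.2 ⟨hz.1, G.fiber (G.kIdx t) \ t,
        Finset.sdiff_subset, Finset.mem_sdiff.2 ⟨hz.1, hvt⟩, ?_, ?_⟩)⟩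
      · intro a ha b hb
        by_cases hbt : b ∈ t
        · exact Finset.mem_union_left _ hbt
        · have hat : a ∉ t := fun h => hbt (ht h hb)
          have haf : G.chain a = G.kIdx t := by
            simpa [GridData.fiber, hat] using ha
          have h1 := chain_anti_aux G hP hb
          have h2 := hout b hbt
          have hbf : G.chain b = G.kIdx t := by omega
          simp [GridData.fiber, hbf]
      · intro a ha b hb
        have hat := (Finset.mem_sdiff.1 ha).1
        have hbt := ht hat hb
        simp [hbt]
end
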